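/- arXiv:2110.07286 — 2 statements merged into one kernel-verified Lean document; each statement's English description precedes it below -/
import Mathlib

section
/- Let k ≥ 2 and n ≥ 0 be integers and set j = 2^{n+1}. Define (c_1,…,c_k) by c_i = 2^{n+1+i} for 1 ≤ i ≤ k−2 and c_{k−1} = c_k = 2^{n+k−1} + 2^n. Then the number of equivalence classes of (c_1,…,c_k)-equiparting matrices is odd. -/
/-- The predecessor-endpoint of the `i`-th consecutive pair in a sequence of
length `2 ^ k`. -/
def finLo (k : ℕ) (i : Fin (2 ^ k - 1)) : Fin (2 ^ k) :=
  ⟨i.val, by have h := i.isLt; have h2 : 0 < 2 ^ k := pow_pos (by norm_num) k; omega⟩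

/-- The successor-endpoint of the `i`-th consecutive pair in a sequence of
length `2 ^ k`. -/
def finHi (k : ℕ) (i : Fin (2 ^ k - 1)) : Fin (2 ^ k) :=
  ⟨i.val + 1, by have h := i.isLt; have h2 : 0 < 2 ^ k := pow_pos (by norm_num) k; omega⟩

/-- A `k`-bit Gray code: a sequence of `2 ^ k` vectors in `{0,1}^k` in which every
vector occurs exactly once and consecutive vectors differ in exactly one coordinate. -/
def IsGrayCode (k : ℕ) (g : Fin (2 ^ k) → Fin k → Bool) : Prop :=
  Function.Bijective g ∧
    ∀ i : Fin (2 ^ k - 1), ∃! t : Fin k, g (finLo k i) t ≠ g (finHi k i) t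

/-- `D` is the delta sequence of `g`: for each `i`, `D i` is the unique coordinate in
which the `i`-th and `(i+1)`-st vector differ. -/
def IsDeltaOf (k : ℕ) (g : Fin (2 ^ k) → Fin k → Bool)
    (D : Fin (2 ^ k - 1) → Fin k) : Prop :=
  ∀ (i : Fin (2 ^ k - 1)) (t : Fin k), (g (finLo k i) t ≠ g (finHi k i) t) ↔ t = D i

/-- A `k`-bit delta sequence: the delta sequence of some `k`-bit Gray code. -/
def IsDeltaSequence (k : ℕ) (D : Fin (2 ^ k - 1) → Fin k) : Prop :=
  ∃ g, IsGrayCode k g ∧ IsDeltaOf k g D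

/-- Transition counts of a sequence over `Fin k`: the number of occurrences of each symbol. -/
def transCount {m k : ℕ} (D : Fin m → Fin k) (t : Fin k) : ℕ :=
  (Finset.univ.filter fun i => D i = t).card

/-- Transition counts of a Gray code: the number of consecutive pairs differing in
coordinate `t`. -/
def grayTransCount (k : ℕ) (g : Fin (2 ^ k) → Fin k → Bool) (t : Fin k) : ℕ :=
  (Finset.univ.filter fun i : Fin (2 ^ k - 1) => g (finLo k i) t ≠ g (finHi k i) t).card

/-- The standard (reflected binary) `k`-bit Gray code, whose `i`-th vector is the
binary expansion of `i XOR (i / 2)`; coordinate `0` (row 1) changes most often.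
This agrees with the inductive definition: the front facet (last coordinate `0`) is
traversed by the standard `(k-1)`-bit Gray code, then the back facet in reverse order. -/
def standardGray (k : ℕ) : Fin (2 ^ k) → Fin k → Bool :=
  fun i t => Nat.testBit (i.val ^^^ (i.val / 2)) t.val

/-- A `(c 0, …, c (k-1))`-equiparting matrix: a `j`-tuple of `k`-bit Gray codes where
the last column of each Gray code equals the first column of the next, and the sum of
the transition counts equals `c`. -/
def IsEquipartingMatrix (j k : ℕ) (c : Fin k → ℕ)
    (G : Fin j → Fin (2 ^ k) → Fin k → Bool) : Prop :=
  (∀ i, IsGrayCode k (G i)) ∧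
    (∀ i : Fin j, ∀ h : i.val + 1 < j,
      G i ⟨2 ^ k - 1, by have h2 : 0 < 2 ^ k := pow_pos (by norm_num) k; omega⟩ =
        G ⟨i.val + 1, h⟩ ⟨0, pow_pos (by norm_num) k⟩) ∧
    ∀ t, (∑ i, grayTransCount k (G i) t) = c t

/-- Two equiparting matrices are isomorphic if they lie in one orbit of `(ℤ/2)^k`,
acting by simultaneously flipping all bits in selected rows. -/
def EMIso (j k : ℕ) (G G' : Fin j → Fin (2 ^ k) → Fin k → Bool) : Prop :=
  ∃ β : Fin k → Bool, ∀ i m t, G' i m t = xor (β t) (G i m t)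

/-- Two equiparting matrices are equivalent if they lie in one orbit of
`(ℤ/2)^k ⋊ Stab`, where `Stab` is the stabilizer of `c` in `S_k`, acting by flipping
bits in selected rows and permuting rows. -/
def EMEquiv (j k : ℕ) (c : Fin k → ℕ)
    (G G' : Fin j → Fin (2 ^ k) → Fin k → Bool) : Prop :=
  ∃ (β : Fin k → Bool) (τ : Equiv.Perm (Fin k)),
    (∀ t, c (τ t) = c t) ∧ ∀ i m t, G' i m t = xor (β t) (G i m (τ t))

/-- The number of isomorphism classes of `c`-equiparting matrices. -/
noncomputable def numIsoClasses (j k : ℕ) (c : Fin k → ℕ) : ℕ :=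
  Nat.card (Quot fun G G' : {G // IsEquipartingMatrix j k c G} => EMIso j k G.1 G'.1)

/-- The number of equivalence classes of `c`-equiparting matrices. -/
noncomputable def numEquivClasses (j k : ℕ) (c : Fin k → ℕ) : ℕ :=
  Nat.card (Quot fun G G' : {G // IsEquipartingMatrix j k c G} => EMEquiv j k c G.1 G'.1)


def EvFree {α : Type} [DecidableEq α] (w : List α) : Prop :=
  ∀ u, u <:+: w → (∀ t, (u.count t).bodd = false) → u = []

def ilv {α : Type} (x : α) (v : List α) : List α := x :: v.flatMap (fun y => [y, x])

def stdW {α : Type} (l : ℕ → α) : ℕ → List α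
  | 0 => []
  | d + 1 => ilv (l d) (stdW l d)

section core
variable {α : Type} [DecidableEq α]

theorem bodd_false_iff (n : ℕ) : n.bodd = false ↔ n % 2 = 0 := by
  rw [Nat.mod_two_of_bodd]; cases n.bodd <;> simp

theorem EvFree.infix {w u : List α} (h : EvFree w) (hu : u <:+: w) : EvFree u :=
  fun v hv he => h v (hv.trans hu) he

theorem EvFree.reverse {w : List α} (h : EvFree w) : EvFree w.reverse := by
  intro u hu he
  have := h u.reverse (by rw [← List.reverse_infix]; simpa using hu) (by simpa using he)
  simpa using this

theorem EvFree.map {w : List α} (h : EvFree w) (σ : Equiv.Perm α) : EvFree (w.map σ) := by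
  intro u hu he
  have h1 : u.map σ.symm <:+: w := by
    have := hu.map σ.symm
    simpa [List.map_map] using this
  have := h _ h1 (fun t => by
    have := he (σ t)
    rw [← List.count_map_of_injective u σ.symm σ.symm.injective] at this
    simpa using this)
  simpa using this

theorem length_even_of_counts (m : List α) (h : ∀ t, (m.count t).bodd = false) :
    m.length % 2 = 0 := by
  rw [← List.sum_toFinset_count_eq_length]
  rw [Finset.sum_nat_mod]
  have : ∑ t ∈ m.toFinset, m.count t % 2 = 0 :=
    Finset.sum_eq_zero (fun t _ => (bodd_false_iff _).1 (h t))
  rw [this]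

theorem ilv_length (x : α) (v : List α) : (ilv x v).length = 2 * v.length + 1 := by
  unfold ilv
  induction v with
  | nil => simp
  | cons y v ih => simp at ih ⊢; omega

theorem fm_count_ne (x t : α) (v : List α) (h : t ≠ x) :
    (v.flatMap (fun y => [y, x])).count t = v.count t := by
  induction v with
  | nil => simp
  | cons y v ih => simp [List.count_cons, ih, h.symm]

theorem fm_count_self (x : α) (v : List α) :
    (v.flatMap (fun y => [y, x])).count x = v.count x + v.length := by
  induction v with
  | nil => simp
  | cons y v ih => simp [List.count_cons, ih]; omega

theorem ilv_count_ne (x t : α) (v : List α) (h : t ≠ x) :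
    (ilv x v).count t = v.count t := by
  unfold ilv
  rw [List.count_cons_of_ne h.symm, fm_count_ne x t v h]

theorem ilv_count_self (x : α) (v : List α) :
    (ilv x v).count x = v.count x + v.length + 1 := by
  unfold ilv
  rw [List.count_cons_self, fm_count_self]

/-- deleting the interleaved letter gives back the word -/
theorem ilv_filter (x : α) (v : List α) (h : x ∉ v) :
    (ilv x v).filter (fun y => y ≠ x) = v := by
  unfold ilv
  simp only [ne_eq, decide_not, List.filter_cons, decide_true, Bool.not_true]
  simp only [Bool.false_eq_true, if_false]
  induction v with
  | nil => simp
  | cons y v ih =>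
    simp only [List.mem_cons, not_or] at h
    have := ih h.2
    simp [List.filter_cons, Ne.symm h.1]
    simpa using this

theorem ilv_noadj (x : α) (v : List α) (h : x ∉ v) : ¬ [x, x] <:+: ilv x v := by
  induction v with
  | nil =>
    intro hh; have := hh.length_le; simp [ilv] at this
  | cons y v ih =>
    simp only [List.mem_cons, not_or] at h
    have e : ilv x (y :: v) = x :: y :: ilv x v := by simp [ilv]
    rw [e]
    intro hh
    rw [List.infix_cons_iff, List.infix_cons_iff] at hh
    rcases hh with hh | hh | hh
    · simp [List.cons_prefix_cons] at hh; exact h.1 hh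
    · simp [List.cons_prefix_cons] at hh; exact h.1 hh.1
    · exact ih h.2 hh

theorem EvFree.ilv {x : α} {v : List α} (hv : EvFree v) (h : x ∉ v) : EvFree (ilv x v) := by
  intro u hu he
  have h1 : u.filter (fun y => y ≠ x) <:+: v := by
    have := hu.filter (fun y => decide (y ≠ x))
    rwa [ilv_filter x v h] at this
  have h2 := hv _ h1 (fun t => by
    by_cases ht : t = x
    · subst ht
      rw [List.count_eq_zero_of_not_mem]; rfl
      simp
    · rw [List.count_filter (by simpa using ht)]; exact he t)
  have h3 : ∀ y ∈ u, y = x := by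
    intro y hy
    by_contra hne
    have : y ∈ u.filter (fun y => y ≠ x) := by simp [hy, hne]
    rw [h2] at this; simp at this
  rcases u with _ | ⟨y, _ | ⟨z, u⟩⟩
  · rfl
  · have := he y; simp at this
  · exfalso
    have hy := h3 y (by simp)
    have hz := h3 z (by simp)
    subst hy; subst hz
    apply ilv_noadj _ v h
    refine List.IsInfix.trans ?_ hu
    exact ⟨[], u, by simp⟩

theorem EvFree.of_ilv {x : α} {v : List α} (hv : EvFree (_root_.ilv x v)) (h : x ∉ v) :
    EvFree v := by
  intro m hm he
  have hxm : x ∉ m := fun hx => h (hm.subset hx)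
  obtain ⟨p, q, rfl⟩ := hm
  have := hv (m.flatMap (fun y => [y, x]))
    ⟨x :: p.flatMap (fun y => [y, x]), q.flatMap (fun y => [y, x]), by simp [_root_.ilv]⟩
    (fun t => by
      by_cases ht : t = x
      · subst ht
        rw [fm_count_self, List.count_eq_zero_of_not_mem hxm, bodd_false_iff]
        have := length_even_of_counts m he
        omega
      · rw [fm_count_ne _ _ _ ht]; exact he t)
  rcases m with _ | ⟨y, m⟩
  · rfl
  · simp at this

theorem exists_ilv (x : α) : ∀ (N : ℕ) (u : List α), u.length ≤ N → ¬ [x, x] <:+: u →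
    u.count x * 2 ≤ u.length + 1 ∧
    (u.length + 1 = u.count x * 2 → u ≠ [] ∧ ∃ v, u = ilv x v ) := by
  intro N
  induction N with
  | zero =>
    intro u hu _
    have : u = [] := by simpa using hu
    subst this; simp
  | succ N ih =>
    intro u hu hadj
    rcases u with _ | ⟨y, _ | ⟨z, u⟩⟩
    · simp
    · simp only [List.count_cons, List.count_nil, List.length_cons, List.length_nil]
      by_cases hy : y = x
      · subst hy; simp; exact ⟨[], rfl⟩
      · simp [hy]
    · have hu' : ¬ [x, x] <:+: u := fun hh => hadj (hh.trans ⟨[y, z], [], by simp⟩)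
      have hzu : ¬ [x, x] <:+: z :: u := fun hh => hadj (hh.trans ⟨[y], [], by simp⟩)
      have i1 := ih u (by simp at hu; omega) hu'
      have i2 := ih (z :: u) (by simp at hu ⊢; omega) hzu
      have hyz : ¬ (y = x ∧ z = x) := by
        rintro ⟨rfl, rfl⟩
        exact hadj ⟨[], u, by simp⟩
      by_cases hy : y = x
      · have hz : z ≠ x := fun hz => hyz ⟨hy, hz⟩
        subst hy
        simp only [List.count_cons, List.length_cons, beq_self_eq_true, if_true,
          beq_iff_eq, hz, if_false]
        refine ⟨by omega, fun h => ⟨by simp, ?_⟩⟩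
        obtain ⟨_, v, rfl⟩ := i1.2 (by omega)
        exact ⟨z :: v, by simp [ilv]⟩
      · by_cases hz : z = x
        · subst hz
          simp only [List.count_cons, List.length_cons, beq_self_eq_true, if_true,
            beq_iff_eq, hy, if_false] at i2 ⊢
          refine ⟨by omega, fun h => ?_⟩
          omega
        · simp only [List.count_cons, List.length_cons,
            beq_iff_eq, hy, hz, if_false]
          refine ⟨by omega, fun h => ?_⟩
          omega

theorem EvFree.noadj {u : List α} (h : EvFree u) (x : α) : ¬ [x, x] <:+: u := by
  intro hh
  have := h _ hh (fun t => by
    simp only [List.count_cons, List.count_nil]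
    by_cases hx : x = t <;> simp [hx])
  simp at this

theorem std_unique (l : ℕ → α) : ∀ (d : ℕ), (∀ i j, i < d → j < d → l i = l j → i = j) →
    ∀ u : List α, u.length + 1 = 2 ^ d → (∀ i < d, u.count (l i) = 2 ^ i) → EvFree u →
    u = stdW l d := by
  intro d
  induction d with
  | zero => intro _ u hu _ _; simpa [stdW] using hu
  | succ d ih =>
    intro hl u hu hc he
    have hd := hc d (by omega)
    obtain ⟨-, v, rfl⟩ := (exists_ilv (l d) _ u le_rfl (he.noadj _)).2 (by rw [hu, hd, pow_succ])
    rw [ilv_length, pow_succ] at hu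
    rw [ilv_count_self] at hd
    have hx : l d ∉ v := List.count_eq_zero.1 (by omega)
    rw [stdW]
    congr 1
    refine ih (fun i j hi hj => hl i j (by omega) (by omega)) v (by omega) (fun i hi => ?_)
      (he.of_ilv hx)
    rw [← hc i (by omega), ilv_count_ne]
    intro h
    have := hl i d (by omega) (by omega) h
    omega

theorem std_length (l : ℕ → α) (d : ℕ) : (stdW l d).length + 1 = 2 ^ d := by
  induction d with
  | zero => simp [stdW]
  | succ d ih => rw [stdW, ilv_length, pow_succ]; omega

theorem std_mem (l : ℕ → α) (d : ℕ) : ∀ x ∈ stdW l d, ∃ i < d, x = l i := by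
  induction d with
  | zero => simp [stdW]
  | succ d ih =>
    intro x hx
    simp only [stdW, ilv, List.mem_cons, List.mem_flatMap, List.not_mem_nil, or_false] at hx
    rcases hx with rfl | ⟨y, hy, rfl | rfl⟩
    · exact ⟨d, by omega, rfl⟩
    · obtain ⟨i, hi, h⟩ := ih _ hy
      exact ⟨i, by omega, h⟩
    · exact ⟨d, by omega, rfl⟩

theorem std_props (l : ℕ → α) : ∀ (d : ℕ), (∀ i j, i < d → j < d → l i = l j → i = j) →
    (∀ i < d, (stdW l d).count (l i) = 2 ^ i) ∧ EvFree (stdW l d) := by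
  intro d
  induction d with
  | zero =>
    intro _
    refine ⟨by simp, ?_⟩
    intro u hu _
    simpa [stdW] using hu
  | succ d ih =>
    intro hl
    obtain ⟨h1, h2⟩ := ih (fun i j hi hj => hl i j (by omega) (by omega))
    have hx : l d ∉ stdW l d := by
      intro h
      obtain ⟨i, hi, h⟩ := std_mem l d _ h
      have := hl d i (by omega) (by omega) h
      omega
    refine ⟨fun i hi => ?_, h2.ilv hx⟩
    rw [stdW]
    by_cases hid : i = d
    · subst hid
      rw [ilv_count_self, List.count_eq_zero_of_not_mem hx]
      have := std_length l i
      omega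
    · rw [ilv_count_ne]
      · exact h1 i (by omega)
      · intro h
        exact hid (hl i d (by omega) (by omega) h)

theorem std_reverse (l : ℕ → α) (d : ℕ) (hl : ∀ i j, i < d → j < d → l i = l j → i = j) :
    (stdW l d).reverse = stdW l d := by
  obtain ⟨h1, h2⟩ := std_props l d hl
  exact std_unique l d hl _ (by simpa using std_length l d) (by simpa using h1) h2.reverse

/-- middle letter analysis -/
theorem middle (w : List α) (N : ℕ) (hN : w.length = 2 * N + 1) (τ : α → α)
    (hτ : Function.Injective τ) (h : w.reverse = w.map τ) :
    ∃ m, τ m = m ∧ (w.count m) % 2 = 1 ∧ (EvFree w → τ = id → w.count m = 1) := by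
  obtain ⟨u, m, v, hw, hu, hv⟩ : ∃ u m v, w = u ++ m :: v ∧ u.length = N ∧ v.length = N := by
    refine ⟨w.take N, w[N], w.drop (N+1), ?_, ?_, ?_⟩
    · simp
    · simp; omega
    · simp; omega
  subst hw
  simp only [List.reverse_append, List.reverse_cons, List.map_append, List.map_cons,
    List.append_assoc, List.singleton_append] at h
  obtain ⟨h1, h2⟩ := List.append_inj h (by simp [hu, hv])
  simp only [List.cons.injEq] at h2
  obtain ⟨h2, h3⟩ := h2
  have hc : v.count m = u.count m := by
    have : v.reverse.count m = (u.map τ).count m := by rw [h1]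
    rw [List.count_reverse] at this
    rw [this]
    conv_lhs => rw [h2]
    exact List.count_map_of_injective u τ hτ m
  refine ⟨m, h2.symm, ?_, ?_⟩
  · simp [List.count_append, hc]; omega
  · intro he ht
    subst ht
    simp only [List.map_id] at h1
    have hmu : m ∉ u := by
      intro hm
      obtain ⟨p, q, rfl⟩ := List.append_of_mem hm
      have hv' : v = q.reverse ++ m :: p.reverse := by
        rw [← List.reverse_reverse v, h1]; simp
      subst hv'
      have := he (m :: q ++ m :: q.reverse) ⟨p, m :: p.reverse, by simp⟩ (fun t => by
        rw [bodd_false_iff]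
        simp [List.count_append, List.count_cons]
        omega)
      simp at this
    simp [List.count_append, hc, List.count_eq_zero_of_not_mem hmu]

end core

section bridge
variable {k : ℕ}

/-- `w` is the transition word of `g` -/
def RW (g : Fin (2 ^ k) → Fin k → Bool) (w : List (Fin k)) : Prop :=
  w.length + 1 = 2 ^ k ∧
    ∀ (m : Fin (2 ^ k)) (t : Fin k),
      g m t = xor (g ⟨0, pow_pos (by norm_num) k⟩ t) ((w.take m.val).count t).bodd

theorem take_succ_bodd (w : List (Fin k)) (i : ℕ) (h : i < w.length) (t : Fin k) :
    ((w.take (i+1)).count t).bodd = xor ((w.take i).count t).bodd (decide (w[i] = t)) := by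
  rw [List.take_succ_eq_append_getElem h, List.count_append, Nat.bodd_add]
  congr 1
  by_cases hh : w[i] = t <;> simp [List.count_cons, hh]

theorem RW.delta {g : Fin (2 ^ k) → Fin k → Bool} {w : List (Fin k)} (h : RW g w)
    (i : Fin (2 ^ k - 1)) (t : Fin k) :
    (g (finLo k i) t ≠ g (finHi k i) t) ↔
      w[i.val]'(by have := i.isLt; have := h.1; omega) = t := by
  have hi : i.val < w.length := by have := i.isLt; have := h.1; omega
  rw [h.2 (finLo k i), h.2 (finHi k i)]
  simp only [finLo, finHi]
  rw [take_succ_bodd w _ hi]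
  by_cases hh : w[i.val] = t <;> simp [hh]

theorem RW.unique {g : Fin (2 ^ k) → Fin k → Bool} {w w' : List (Fin k)} (h : RW g w)
    (h' : RW g w') : w = w' := by
  apply List.ext_getElem
  · have := h.1; have := h'.1; omega
  · intro i h1 h2
    have e := h.delta ⟨i, by have := h.1; omega⟩ w[i]
    have e' := h'.delta ⟨i, by have := h.1; omega⟩ w[i]
    exact (e'.1 (e.2 rfl)).symm

theorem card_filter_ofFn {α : Type} [DecidableEq α] (t : α) : ∀ (n : ℕ) (f : Fin n → α),
    (Finset.univ.filter (fun i => f i = t)).card = (List.ofFn f).count t := by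
  intro n
  induction n with
  | zero => intro f; simp
  | succ n ih =>
    intro f
    rw [List.ofFn_succ, List.count_cons, ← ih, Fin.card_filter_univ_succ]
    by_cases h : f 0 = t <;> simp [h]

theorem RW.transCount {g : Fin (2 ^ k) → Fin k → Bool} {w : List (Fin k)} (h : RW g w)
    (t : Fin k) : grayTransCount k g t = w.count t := by
  unfold grayTransCount
  have hl : w.length = 2 ^ k - 1 := by have := h.1; omega
  have : w = List.ofFn (fun i : Fin (2 ^ k - 1) => w[i.val]'(by omega)) := by
    apply List.ext_getElem
    · simp [hl]
    · intro i h1 h2; simp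
  conv_rhs => rw [this]
  rw [← card_filter_ofFn]
  congr 1
  ext i
  simp only [Finset.mem_filter, Finset.mem_univ, true_and]
  exact h.delta i t

theorem exists_RW {g : Fin (2 ^ k) → Fin k → Bool} (hg : IsGrayCode k g) :
    ∃ w, RW g w ∧ EvFree w := by
  choose d hd hd' using hg.2
  have hlen : (List.ofFn d).length + 1 = 2 ^ k := by
    have : 0 < 2 ^ k := pow_pos (by norm_num) k
    simp; omega
  have key : ∀ (m : ℕ) (hm : m < 2 ^ k) (t : Fin k), g ⟨m, hm⟩ t =
      xor (g ⟨0, pow_pos (by norm_num) k⟩ t) (((List.ofFn d).take m).count t).bodd := by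
    intro m
    induction m with
    | zero => intro hm t; simp
    | succ m ih =>
      intro hm t
      have hm' : m < (List.ofFn d).length := by omega
      rw [take_succ_bodd _ _ hm', ← Bool.xor_assoc, ← ih (by omega) t]
      have e1 := hd ⟨m, by omega⟩
      have e2 := hd' ⟨m, by omega⟩ t
      simp only [finLo, finHi] at e1 e2
      simp only [List.getElem_ofFn]
      by_cases hh : d ⟨m, by omega⟩ = t
      · subst hh
        revert e1
        cases g ⟨m, _⟩ (d ⟨m, by omega⟩) <;> cases g ⟨m + 1, _⟩ (d ⟨m, by omega⟩) <;> simp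
      · simp only [hh, decide_false, Bool.xor_false]
        by_contra hne
        exact hh (e2 (fun h => hne h.symm)).symm
  refine ⟨List.ofFn d, ⟨hlen, fun m t => key m.val m.isLt t⟩, ?_⟩
  generalize List.ofFn d = w at *
  rintro m ⟨p, q, hw⟩ he
  have hlw : w.length = p.length + m.length + q.length := by rw [← hw]; simp; omega
  have e1 : w.take p.length = p := by rw [← hw]; simp
  have e2 : w.take (p.length + m.length) = p ++ m := by 
    rw [← hw, ← List.length_append, List.take_left]
  have : g ⟨p.length, by omega⟩ = g ⟨p.length + m.length, by omega⟩ := by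
    funext t
    rw [key p.length, key (p.length + m.length), e1, e2, List.count_append, Nat.bodd_add, he t]; simp
  have := hg.1.1 this
  simp at this
  exact this

theorem gray_of_RW {g : Fin (2 ^ k) → Fin k → Bool} {w : List (Fin k)} (h : RW g w)
    (he : EvFree w) : IsGrayCode k g := by
  have key : ∀ m m' : Fin (2 ^ k), m.val < m'.val → g m ≠ g m' := by
    intro m m' hlt heq
    have hl := h.1
    have := m'.isLt
    have e : w.take m'.val = w.take m.val ++ (w.take m'.val).drop m.val := by
      conv_lhs => rw [← List.take_append_drop m.val (w.take m'.val)]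
      rw [List.take_take, min_eq_left hlt.le]
    have hz := he ((w.take m'.val).drop m.val)
      ((List.drop_suffix _ _).isInfix.trans (List.take_prefix _ _).isInfix) (fun t => by
        have h1 := h.2 m t
        have h2 := h.2 m' t
        rw [e, List.count_append, Nat.bodd_add, ← Bool.xor_assoc, ← h1, heq] at h2
        revert h2
        cases g m' t <;> simp)
    have := congrArg List.length hz
    simp at this
    omega
  refine ⟨?_, fun i => ?_⟩
  · rw [Fintype.bijective_iff_injective_and_card]
    refine ⟨fun m m' hm => ?_, by simp⟩
    rcases lt_trichotomy m.val m'.val with hlt | heq | hlt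
    · exact absurd hm (key _ _ hlt)
    · exact Fin.ext heq
    · exact absurd hm.symm (key _ _ hlt)
  · refine ⟨w[i.val]'(by have := i.isLt; have := h.1; omega), (h.delta i _).2 rfl, ?_⟩
    intro t ht
    exact ((h.delta i t).1 ht).symm

/-- tuples of words -/
def SW (j k : ℕ) (c : Fin k → ℕ) (D : Fin j → List (Fin k)) : Prop :=
  (∀ i, (D i).length + 1 = 2 ^ k ∧ EvFree (D i)) ∧ ∀ t, ∑ i, (D i).count t = c t

theorem exists_words {j : ℕ} {c : Fin k → ℕ} {G : Fin j → Fin (2 ^ k) → Fin k → Bool}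
    (hG : IsEquipartingMatrix j k c G) : ∃ D, SW j k c D ∧ ∀ i, RW (G i) (D i) := by
  choose D hD hD' using fun i => exists_RW (hG.1 i)
  refine ⟨D, ⟨fun i => ⟨(hD i).1, hD' i⟩, fun t => ?_⟩, hD⟩
  rw [← hG.2.2 t]
  exact Finset.sum_congr rfl (fun i _ => ((hD i).transCount t).symm)

theorem exists_matrix {j : ℕ} {c : Fin k → ℕ} {D : Fin j → List (Fin k)}
    (hD : SW j k c D) : ∃ G, IsEquipartingMatrix j k c G ∧ ∀ i, RW (G i) (D i) := by
  let st : ℕ → Fin k → ℕ := fun n t =>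
    ∑ i ∈ Finset.range n, if h : i < j then (D ⟨i, h⟩).count t else 0
  let G : Fin j → Fin (2 ^ k) → Fin k → Bool := fun i m t =>
    xor (st i.val t).bodd (((D i).take m.val).count t).bodd
  have hR : ∀ i, RW (G i) (D i) := by
    intro i
    refine ⟨(hD.1 i).1, fun m t => ?_⟩
    simp [G]
  refine ⟨G, ⟨fun i => gray_of_RW (hR i) (hD.1 i).2, ?_, ?_⟩, hR⟩
  · intro i h
    funext t
    have e : (D i).take (2 ^ k - 1) = D i := by
      apply List.take_of_length_le
      have := (hD.1 i).1
      omega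
    simp [G, e, st, Finset.sum_range_succ]
  · intro t
    rw [← hD.2 t]
    exact Finset.sum_congr rfl (fun i _ => (hR i).transCount t)

theorem count_map_perm (τ : Equiv.Perm (Fin k)) (w : List (Fin k)) (t : Fin k) :
    (w.map τ).count (τ t) = w.count t := List.count_map_of_injective w τ τ.injective t

theorem RW.act {g g' : Fin (2 ^ k) → Fin k → Bool} {w : List (Fin k)} (h : RW g w)
    (β : Fin k → Bool) (τ : Equiv.Perm (Fin k))
    (hg : ∀ m t, g' m t = xor (β t) (g m (τ t))) : RW g' (w.map τ.symm) := by
  refine ⟨by simpa using h.1, fun m t => ?_⟩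
  rw [hg, hg, h.2 m, ← List.map_take]
  have := count_map_perm τ.symm (w.take m.val) (τ t)
  rw [Equiv.symm_apply_apply] at this
  rw [this, Bool.xor_assoc]

theorem equiv_of_words {j : ℕ} {c : Fin k → ℕ} {G G' : Fin j → Fin (2 ^ k) → Fin k → Bool}
    (hG : IsEquipartingMatrix j k c G) (hG' : IsEquipartingMatrix j k c G')
    (D : Fin j → List (Fin k)) (hD : ∀ i, RW (G i) (D i)) (τ : Equiv.Perm (Fin k))
    (hτ : ∀ t, c (τ t) = c t) (hD' : ∀ i, RW (G' i) ((D i).map τ.symm)) :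
    EMEquiv j k c G G' := by
  have hp : 0 < 2 ^ k := pow_pos (by norm_num) k
  rcases Nat.eq_zero_or_pos j with rfl | hj
  · exact ⟨fun _ => false, τ, hτ, fun i => i.elim0⟩
  have hc : ∀ i m t, (((((D i).map τ.symm).take m).count t)) = ((D i).take m).count (τ t) := by
    intro i m t
    rw [← List.map_take]
    have := count_map_perm τ.symm ((D i).take m) (τ t)
    rwa [Equiv.symm_apply_apply] at this
  let β : Fin k → Bool := fun t => xor (G' ⟨0, hj⟩ ⟨0, hp⟩ t) (G ⟨0, hj⟩ ⟨0, hp⟩ (τ t))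
  have h0 : ∀ (i : ℕ) (hi : i < j) t,
      G' ⟨i, hi⟩ ⟨0, hp⟩ t = xor (β t) (G ⟨i, hi⟩ ⟨0, hp⟩ (τ t)) := by
    intro i
    induction i with
    | zero =>
      intro hi t
      simp [β]
    | succ i ih =>
      intro hi t
      have e1 := hG.2.1 ⟨i, by omega⟩ hi
      have e2 := hG'.2.1 ⟨i, by omega⟩ hi
      simp only at e1 e2
      rw [← e1, ← e2, (hD' _).2, (hD _).2, hc, ih, Bool.xor_assoc]
  refine ⟨β, τ, hτ, fun i m t => ?_⟩
  rw [(hD' _).2, (hD _).2, hc, h0 i.val i.isLt, Bool.xor_assoc]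

end bridge

section parity

theorem parity_fix {X : Type} [Finite X] (f : X → X) (m : ℕ) (h : f^[2 ^ m] = id) :
    Nat.card X ≡ Nat.card {x // f x = x} [MOD 2] := by
  classical
  have : Fintype X := Fintype.ofFinite X
  haveI : Fact (Nat.Prime 2) := ⟨Nat.prime_two⟩
  have key : ∀ f' : Function.End X, f'^[2 ^ m] = id →
      Nat.card X ≡ Nat.card {x // f' x = x} [MOD 2] := by
    intro f' hf
    have h' : f' ^ (2 ^ m) = 1 :=
      (hom_coe_pow (fun g : Function.End X => g) rfl (fun _ _ => rfl) f' (2 ^ m)).trans hf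
    have := Equiv.Perm.card_fixedPoints_modEq h'
    rw [← Nat.card_eq_fintype_card, ← Nat.card_eq_fintype_card] at this
    exact this
  exact key f h

theorem odd_two {T : Type} [Finite T] (ρ r : T → T) (m : ℕ) (hρ : ρ^[2 ^ m] = id)
    (hr : ∀ x, r (r x) = x) (hc : ∀ x, ρ (r x) = r (ρ x)) (x0 : T) (h1 : ρ x0 = x0)
    (h2 : r x0 = x0) (hu : ∀ x, ρ x = x → r x = x → x = x0) : Odd (Nat.card T) := by
  have p1 := parity_fix ρ m hρ
  let r' : {x // ρ x = x} → {x // ρ x = x} := fun x => ⟨r x.1, by rw [hc, x.2]⟩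
  have p2 := parity_fix r' 1 (by funext x; apply Subtype.ext; exact hr x.1)
  have p3 : Nat.card {x // r' x = x} = 1 := by
    rw [Nat.card_eq_one_iff_unique]
    refine ⟨⟨fun x y => ?_⟩, ⟨⟨⟨x0, h1⟩, Subtype.ext h2⟩⟩⟩
    apply Subtype.ext; apply Subtype.ext
    rw [hu x.1.1 x.1.2 (congrArg Subtype.val x.2), hu y.1.1 y.1.2 (congrArg Subtype.val y.2)]
  rw [p3] at p2
  have := p1.trans p2
  rw [Nat.odd_iff]
  exact this

def relS {S : Type} (s : S → S) (hs : ∀ x, s (s x) = x) : Setoid S where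
  r x y := y = x ∨ y = s x
  iseqv := by
    refine ⟨fun x => Or.inl rfl, ?_, ?_⟩
    · rintro x y (rfl | rfl)
      · exact Or.inl rfl
      · exact Or.inr (hs x).symm
    · rintro x y z (rfl | rfl) (rfl | rfl)
      · exact Or.inl rfl
      · exact Or.inr rfl
      · exact Or.inr rfl
      · exact Or.inl (hs x)

theorem odd_quot {S : Type} (s sh rv : S → S) (hs : ∀ x, s (s x) = x)
    [Finite (Quotient (relS s hs))]
    (m : ℕ) (hsh : sh^[2 ^ m] = id) (hrv : ∀ x, rv (rv x) = x)
    (c1 : ∀ x, sh (s x) = s (sh x)) (c2 : ∀ x, rv (s x) = s (rv x))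
    (c3 : ∀ x, sh (rv x) = rv (sh x)) (x0 : S) (h1 : sh x0 = s x0) (h2 : rv x0 = x0)
    (hu : ∀ x, (sh x = x ∨ sh x = s x) → (rv x = x ∨ rv x = s x) → x = x0 ∨ x = s x0) :
    Odd (Nat.card (Quotient (relS s hs))) := by
  let ρ : Quotient (relS s hs) → Quotient (relS s hs) := Quotient.map sh (by
    rintro x y (rfl | rfl)
    · exact Or.inl rfl
    · exact Or.inr (c1 x))
  let r : Quotient (relS s hs) → Quotient (relS s hs) := Quotient.map rv (by
    rintro x y (rfl | rfl)
    · exact Or.inl rfl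
    · exact Or.inr (c2 x))
  have hρ : ∀ x, ρ (Quotient.mk _ x) = Quotient.mk _ (sh x) := fun x => rfl
  have hr : ∀ x, r (Quotient.mk _ x) = Quotient.mk _ (rv x) := fun x => rfl
  have hit : ∀ (n : ℕ) x, ρ^[n] (Quotient.mk _ x) = Quotient.mk _ (sh^[n] x) := by
    intro n
    induction n with
    | zero => intro x; rfl
    | succ n ih => intro x; rw [Function.iterate_succ_apply, hρ, ih, Function.iterate_succ_apply]
  have ex : ∀ {x y : S}, (Quotient.mk (relS s hs) x = Quotient.mk (relS s hs) y) →
      x = y ∨ x = s y := by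
    intro x y h
    exact Quotient.exact h.symm
  refine odd_two ρ r m ?_ ?_ ?_ (Quotient.mk _ x0) ?_ ?_ ?_
  · funext x
    induction x using Quotient.ind with | _ x => rw [hit, hsh]; rfl
  · intro x
    induction x using Quotient.ind with | _ x => rw [hr, hr, hrv]
  · intro x
    induction x using Quotient.ind with | _ x => rw [hr, hρ, hρ, hr, c3]
  · rw [hρ]; exact (Quotient.sound (s := relS s hs) (Or.inr h1)).symm
  · rw [hr, h2]
  · intro x
    induction x using Quotient.ind with
    | _ x =>
      intro e1 e2
      rcases hu x (ex e1) (ex e2) with h | h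
      · rw [h]
      · exact (Quotient.sound (s := relS s hs) (Or.inr h)).symm

end parity

section final

theorem fin_ind {j : ℕ} [NeZero j] (P : Fin j → Prop) (h0 : P 0)
    (hs : ∀ i, P i → P (i + 1)) : ∀ i, P i := by
  have key : ∀ (m : ℕ) (h : m < j), P ⟨m, h⟩ := by
    intro m
    induction m with
    | zero => intro h; exact h0
    | succ m ih =>
      intro h
      have := hs _ (ih (by omega))
      convert this using 1
      apply Fin.ext
      rw [Fin.val_add, Fin.val_one']
      simp [Nat.mod_eq_of_lt h]
  exact fun i => key i.val i.isLt

theorem add_one_iter {j : ℕ} [NeZero j] (m : ℕ) (i : Fin j) :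
    (((fun x : Fin j => x + 1)^[m]) i).val = (i.val + m) % j := by
  induction m with
  | zero => simp [Nat.mod_eq_of_lt i.isLt]
  | succ m ih =>
    rw [Function.iterate_succ_apply', Fin.val_add, ih, Fin.val_one']
    simp [Nat.add_assoc]

theorem count_map_inv {k : ℕ} (τ : Equiv.Perm (Fin k)) (hτ : ∀ t, τ (τ t) = t)
    (w : List (Fin k)) (t : Fin k) : (w.map τ).count t = w.count (τ t) := by
  have := count_map_perm τ w (τ t)
  rwa [hτ] at this

theorem wmap_inv {k : ℕ} (τ : Equiv.Perm (Fin k)) (hτ : ∀ t, τ (τ t) = t)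
    (w : List (Fin k)) : (w.map τ).map τ = w := by
  rw [List.map_map]
  have : (τ ∘ τ : Fin k → Fin k) = id := funext hτ
  rw [this, List.map_id]

theorem alt_sum {j k : ℕ} [NeZero j] (τ : Equiv.Perm (Fin k)) (hτ : ∀ t, τ (τ t) = t)
    (D : Fin j → List (Fin k)) (hD : ∀ i, D (i + 1) = (D i).map τ) (t : Fin k) :
    2 * ∑ i, (D i).count t = j * ((D 0).count t + (D 0).count (τ t)) := by
  have e1 : ∑ i, (D i).count t = ∑ i, (D i).count (τ t) := by
    rw [← Equiv.sum_comp (Equiv.addRight (1 : Fin j))]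
    refine Finset.sum_congr rfl (fun i _ => ?_)
    rw [Equiv.coe_addRight, hD, count_map_inv τ hτ]
  have e2 : ∀ i, (D i).count t + (D i).count (τ t) = (D 0).count t + (D 0).count (τ t) := by
    apply fin_ind
    · rfl
    · intro i hi
      rw [hD, count_map_inv τ hτ, count_map_inv τ hτ, hτ, ← hi, add_comm]
  rw [two_mul]
  conv_lhs => rw [e1]
  conv_lhs => enter [1]; rw [← e1]
  rw [← Finset.sum_add_distrib, Finset.sum_congr rfl (fun i _ => e2 i)]
  simp

/-- the two last letters, the letter ordering -/
def lA (K : ℕ) : Fin (K + 2) := ⟨K, by omega⟩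
def lB (K : ℕ) : Fin (K + 2) := ⟨K + 1, by omega⟩
def ltr (K : ℕ) (i : ℕ) : Fin (K + 2) := ⟨(i + (K + 1)) % (K + 2), Nat.mod_lt _ (by omega)⟩
def sg (K : ℕ) : Equiv.Perm (Fin (K + 2)) := Equiv.swap (lA K) (lB K)

theorem sg_sg (K : ℕ) (t) : sg K (sg K t) = t := by simp [sg]
theorem sg_A (K : ℕ) : sg K (lA K) = lB K := by simp [sg]
theorem sg_B (K : ℕ) : sg K (lB K) = lA K := by simp [sg]
theorem AneB (K : ℕ) : lA K ≠ lB K := by simp [lA, lB]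
theorem sg_lt (K : ℕ) (t : Fin (K + 2)) (h : t.val < K) : sg K t = t := by
  apply Equiv.swap_apply_of_ne_of_ne
  · intro e; rw [e] at h; simp [lA] at h
  · intro e; rw [e] at h; simp [lB] at h
theorem tri (K : ℕ) (t : Fin (K + 2)) : t.val < K ∨ t = lA K ∨ t = lB K := by
  have := t.isLt
  by_cases h : t.val < K
  · exact Or.inl h
  · by_cases h' : t.val = K
    · exact Or.inr (Or.inl (Fin.ext h'))
    · exact Or.inr (Or.inr (Fin.ext (by simp [lB]; omega)))

theorem ltr_zero (K : ℕ) : ltr K 0 = lB K := by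
  apply Fin.ext; simp [ltr, lB]
theorem ltr_succ (K i : ℕ) (h : i < K + 1) : (ltr K (i + 1)).val = i := by
  have : i + 1 + (K + 1) = i + (K + 2) := by ring
  simp only [ltr, this, Nat.add_mod_right]
  exact Nat.mod_eq_of_lt (by omega)
theorem ltr_inj (K : ℕ) : ∀ i j, i < K + 2 → j < K + 2 → ltr K i = ltr K j → i = j := by
  intro i j hi hj h
  rcases i with _ | i <;> rcases j with _ | j
  · rfl
  · have := congrArg Fin.val h
    rw [ltr_succ K j (by omega), ltr_zero] at this
    simp [lB] at this; omega
  · have := congrArg Fin.val h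
    rw [ltr_succ K i (by omega), ltr_zero] at this
    simp [lB] at this; omega
  · have := congrArg Fin.val h
    rw [ltr_succ K j (by omega), ltr_succ K i (by omega)] at this
    omega

def stw (K : ℕ) : List (Fin (K + 2)) := stdW (ltr K) (K + 2)

def eF (K : ℕ) (t : Fin (K + 2)) : ℕ := if t.val < K then 2 ^ (t.val + 2) else 2 ^ (K + 1) + 1

theorem eF_A (K : ℕ) : eF K (lA K) = 2 ^ (K + 1) + 1 := by simp [eF, lA]
theorem eF_B (K : ℕ) : eF K (lB K) = 2 ^ (K + 1) + 1 := by simp [eF, lB]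

theorem stw_count_B (K : ℕ) : (stw K).count (lB K) = 1 := by
  have := (std_props (ltr K) (K + 2) (ltr_inj K)).1 0 (by omega)
  rwa [ltr_zero] at this

theorem stw_count (K : ℕ) (t : Fin (K + 2)) (h : t.val < K + 1) :
    (stw K).count t = 2 ^ (t.val + 1) := by
  have := (std_props (ltr K) (K + 2) (ltr_inj K)).1 (t.val + 1) (by omega)
  have e : ltr K (t.val + 1) = t := Fin.ext (ltr_succ K _ h)
  rwa [e] at this

theorem stw_sum (K : ℕ) (t : Fin (K + 2)) :
    (stw K).count t + (stw K).count (sg K t) = eF K t := by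
  have hA := stw_count K (lA K) (by simp [lA])
  have hB := stw_count_B K
  have : (lA K).val = K := rfl
  rw [this] at hA
  rcases tri K t with h | rfl | rfl
  · rw [sg_lt K t h, stw_count K t (by omega), eF, if_pos h]; ring
  · rw [sg_A, hA, hB, eF_A]
  · rw [sg_B, hA, hB, eF_B]; ring

theorem word_eq (K : ℕ) (w : List (Fin (K + 2))) (hl : w.length + 1 = 2 ^ (K + 2))
    (he : EvFree w) (hs : ∀ t, w.count t + w.count (sg K t) = eF K t)
    (hB : w.count (lB K) = 1) : w = stw K := by
  refine std_unique (ltr K) (K + 2) (ltr_inj K) w hl ?_ he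
  intro i hi
  rcases i with _ | i
  · rw [ltr_zero, hB]; rfl
  · have hv := ltr_succ K i (by omega)
    have := hs (ltr K (i + 1))
    by_cases h : i < K
    · rw [sg_lt K _ (by omega), eF, if_pos (by omega), hv] at this
      rw [pow_succ] at this
      omega
    · have e : ltr K (i + 1) = lA K := Fin.ext (by rw [hv]; simp [lA]; omega)
      have hi' : i = K := by omega
      rw [e, sg_A, hB, eF_A] at this
      rw [e, hi']
      omega

theorem classify (K : ℕ) (w : List (Fin (K + 2))) (hl : w.length + 1 = 2 ^ (K + 2))
    (he : EvFree w) (hs : ∀ t, w.count t + w.count (sg K t) = eF K t)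
    (hr : w.reverse = w ∨ w.reverse = w.map (sg K)) : w = stw K ∨ w.map (sg K) = stw K := by
  have hp : w.length = 2 * (2 ^ (K + 1) - 1) + 1 := by
    rw [pow_succ] at hl
    have : 0 < 2 ^ (K + 1) := by positivity
    omega
  have hev : ∀ t : Fin (K + 2), t.val < K → w.count t % 2 = 0 := by
    intro t ht
    have := hs t
    rw [sg_lt K t ht, eF, if_pos ht, pow_succ, pow_succ] at this
    omega
  rcases hr with hr | hr
  · obtain ⟨m, -, hodd, h1⟩ := middle w _ hp id Function.injective_id (by simpa using hr)
    have h1 := h1 he rfl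
    rcases tri K m with h | rfl | rfl
    · have := hev m h; omega
    · right
      refine word_eq K _ (by simpa using hl) (he.map _) (fun t => ?_) ?_
      · rw [count_map_inv _ (sg_sg K), count_map_inv _ (sg_sg K), sg_sg, add_comm]
        exact hs t
      · rw [count_map_inv _ (sg_sg K), sg_B]; exact h1
    · left
      exact word_eq K w hl he hs h1
  · exfalso
    obtain ⟨m, hm, hodd, -⟩ := middle w _ hp (sg K) (sg K).injective hr
    rcases tri K m with h | rfl | rfl
    · have := hev m h; omega
    · rw [sg_A] at hm; exact AneB K hm.symm
    · rw [sg_B] at hm; exact AneB K hm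

def cF (n K : ℕ) (t : Fin (K + 2)) : ℕ :=
  if t.val + 3 ≤ K + 2 then 2 ^ (n + 2 + t.val) else 2 ^ (n + (K + 2) - 1) + 2 ^ n

theorem cF_eF (n K : ℕ) (t : Fin (K + 2)) : 2 * cF n K t = 2 ^ (n + 1) * eF K t := by
  unfold cF eF
  by_cases h : t.val < K
  · rw [if_pos (by omega), if_pos h]; ring
  · rw [if_neg (by omega), if_neg h]
    have : n + (K + 2) - 1 = n + K + 1 := by omega
    rw [this]; ring

theorem eF_sg (K : ℕ) (t : Fin (K + 2)) : eF K (sg K t) = eF K t := by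
  rcases tri K t with h | rfl | rfl
  · rw [sg_lt K t h]
  · rw [sg_A, eF_A, eF_B]
  · rw [sg_B, eF_A, eF_B]

theorem cF_inj (n K : ℕ) (s t : Fin (K + 2)) (h : cF n K s = cF n K t) : eF K s = eF K t := by
  have h1 := cF_eF n K s
  have h2 := cF_eF n K t
  rw [h, h2] at h1
  exact (Nat.eq_of_mul_eq_mul_left (by positivity) h1).symm

theorem cF_sg (n K : ℕ) (t : Fin (K + 2)) : cF n K (sg K t) = cF n K t := by
  have h1 := cF_eF n K (sg K t)
  have h2 := cF_eF n K t
  rw [eF_sg] at h1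
  omega

theorem stab (n K : ℕ) (τ : Equiv.Perm (Fin (K + 2))) (h : ∀ t, cF n K (τ t) = cF n K t) :
    τ = 1 ∨ τ = sg K := by
  have h' : ∀ t, eF K (τ t) = eF K t := fun t => cF_inj n K _ _ (h t)
  have podd : ∀ m : ℕ, 2 ^ (m + 2) ≠ 2 ^ (K + 1) + 1 := by
    intro m e
    rw [pow_succ, pow_succ 2 K] at e
    omega
  have fix : ∀ t : Fin (K + 2), t.val < K → τ t = t := by
    intro t ht
    have e := h' t
    rw [eF, eF, if_pos ht] at e
    split_ifs at e with h2
    · have := Nat.pow_right_injective (le_refl 2) e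
      exact Fin.ext (by omega)
    · exact absurd e.symm (podd _)
  have hAB : ∀ t : Fin (K + 2), ¬ t.val < K → ¬ (τ t).val < K := by
    intro t ht ht'
    have := τ.injective (fix _ ht')
    rw [this] at ht'
    exact ht ht'
  have hA : τ (lA K) = lA K ∨ τ (lA K) = lB K := by
    rcases tri K (τ (lA K)) with h | h | h
    · exact absurd h (hAB _ (by simp [lA]))
    · exact Or.inl h
    · exact Or.inr h
  have hB : τ (lB K) = lA K ∨ τ (lB K) = lB K := by
    rcases tri K (τ (lB K)) with h | h | h
    · exact absurd h (hAB _ (by simp [lB]))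
    · exact Or.inl h
    · exact Or.inr h
  have hne : τ (lA K) ≠ τ (lB K) := fun e => AneB K (τ.injective e)
  rcases hA with hA | hA
  · left
    have hB' : τ (lB K) = lB K := by
      rcases hB with hB | hB
      · exact absurd (hA.trans hB.symm) hne
      · exact hB
    ext t
    rcases tri K t with h | rfl | rfl
    · rw [fix t h]; rfl
    · rw [hA]; rfl
    · rw [hB']; rfl
  · right
    have hB' : τ (lB K) = lA K := by
      rcases hB with hB | hB
      · exact hB
      · exact absurd (hA.trans hB.symm) hne
    ext t
    rcases tri K t with h | rfl | rfl
    · rw [fix t h, sg_lt K t h]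
    · rw [hA, sg_A]
    · rw [hB', sg_B]

/-- the type of tuples of words -/
abbrev WTup (n K : ℕ) := {D : Fin (2 ^ (n + 1)) → List (Fin (K + 2)) //
  SW (2 ^ (n + 1)) (K + 2) (cF n K) D}

def sS (n K : ℕ) (D : WTup n K) : WTup n K :=
  ⟨fun i => (D.1 i).map (sg K), fun i => ⟨by simpa using (D.2.1 i).1, (D.2.1 i).2.map _⟩,
    fun t => by
      simp only [count_map_inv _ (sg_sg K)]
      rw [D.2.2, cF_sg]⟩

def rS (n K : ℕ) (D : WTup n K) : WTup n K :=
  ⟨fun i => (D.1 i).reverse, fun i => ⟨by simpa using (D.2.1 i).1, (D.2.1 i).2.reverse⟩,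
    fun t => by
      simp only [List.count_reverse]
      rw [D.2.2]⟩

def hS (n K : ℕ) (D : WTup n K) : WTup n K :=
  ⟨fun i => D.1 (i + 1), fun i => D.2.1 (i + 1),
    fun t => by
      rw [← D.2.2]
      exact Equiv.sum_comp (Equiv.addRight (1 : Fin (2 ^ (n + 1)))) (fun i => (D.1 i).count t)⟩

theorem sS_sS (n K : ℕ) (D : WTup n K) : sS n K (sS n K D) = D := by
  apply Subtype.ext
  funext i
  exact wmap_inv _ (sg_sg K) _

def xW (n K : ℕ) (i : Fin (2 ^ (n + 1))) : List (Fin (K + 2)) :=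
  if i.val % 2 = 0 then stw K else (stw K).map (sg K)

theorem xW_succ (n K : ℕ) (i : Fin (2 ^ (n + 1))) : xW n K (i + 1) = (xW n K i).map (sg K) := by
  have h2 : (i + 1).val % 2 = (i.val + 1) % 2 := by
    rw [Fin.val_add, Fin.val_one', Nat.add_mod_mod]
    exact Nat.mod_mod_of_dvd _ (dvd_pow_self 2 (by omega))
  unfold xW
  rw [h2]
  by_cases h : i.val % 2 = 0
  · rw [if_neg (by omega), if_pos h]
  · rw [if_pos (by omega), if_neg h, wmap_inv _ (sg_sg K)]

theorem xW_zero (n K : ℕ) : xW n K 0 = stw K := by simp [xW]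

def x0 (n K : ℕ) : WTup n K := ⟨xW n K, by
    intro i
    have h1 : (stw K).length + 1 = 2 ^ (K + 2) := std_length _ _
    have h2 : EvFree (stw K) := (std_props (ltr K) (K + 2) (ltr_inj K)).2
    unfold xW
    split_ifs
    · exact ⟨h1, h2⟩
    · exact ⟨by simpa using h1, h2.map _⟩, by
    intro t
    have := alt_sum (sg K) (sg_sg K) (xW n K) (xW_succ n K) t
    rw [xW_zero, stw_sum, ← cF_eF] at this
    omega⟩

theorem odd_ST (n K : ℕ) [Finite (Quotient (relS (sS n K) (sS_sS n K)))] :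
    Odd (Nat.card (Quotient (relS (sS n K) (sS_sS n K)))) := by
  refine odd_quot (sS n K) (hS n K) (rS n K) (sS_sS n K) (n + 1) ?_ ?_ ?_ ?_ ?_ (x0 n K) ?_ ?_ ?_
  · funext D
    have : ∀ (m : ℕ) (D : WTup n K) i, ((hS n K)^[m] D).1 i = D.1 ((fun x => x + 1)^[m] i) := by
      intro m
      induction m with
      | zero => intro D i; rfl
      | succ m ih =>
        intro D i
        rw [Function.iterate_succ_apply, ih, Function.iterate_succ_apply']
        rfl
    apply Subtype.ext
    funext i
    rw [this]
    refine congrArg D.1 ?_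
    apply Fin.ext
    rw [add_one_iter, Nat.add_mod_right, Nat.mod_eq_of_lt i.isLt]
  · intro D
    apply Subtype.ext; funext i
    exact List.reverse_reverse _
  · intro D; rfl
  · intro D
    apply Subtype.ext; funext i
    exact (List.map_reverse).symm
  · intro D; rfl
  · apply Subtype.ext; funext i
    exact xW_succ n K i
  · apply Subtype.ext; funext i
    have h : (stw K).reverse = stw K := std_reverse _ _ (ltr_inj K)
    show (xW n K i).reverse = xW n K i
    unfold xW
    split_ifs
    · exact h
    · rw [← List.map_reverse, h]
  · intro D h1 h2
    have halt : ∀ i, D.1 (i + 1) = (D.1 i).map (sg K) := by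
      rcases h1 with h1 | h1
      · exfalso
        have := alt_sum (1 : Equiv.Perm (Fin (K + 2))) (fun t => rfl) D.1 (fun i => by
          have := congrFun (congrArg Subtype.val h1) i
          simp only [hS] at this
          rw [this]; simp) (lB K)
        rw [D.2.2, cF_eF] at this
        have := Nat.eq_of_mul_eq_mul_left (by positivity) this
        rw [eF_B, pow_succ] at this
        simp only [Equiv.Perm.coe_one, id_eq] at this
        omega
      · intro i
        exact congrFun (congrArg Subtype.val h1) i
    have hsum : ∀ t, (D.1 0).count t + (D.1 0).count (sg K t) = eF K t := by
      intro t
      have := alt_sum (sg K) (sg_sg K) D.1 halt t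
      rw [D.2.2, cF_eF] at this
      exact (Nat.eq_of_mul_eq_mul_left (by positivity) this).symm
    have hr : (D.1 0).reverse = D.1 0 ∨ (D.1 0).reverse = (D.1 0).map (sg K) := by
      rcases h2 with h2 | h2
      · exact Or.inl (congrFun (congrArg Subtype.val h2) 0)
      · exact Or.inr (congrFun (congrArg Subtype.val h2) 0)
    rcases classify K _ (D.2.1 0).1 (D.2.1 0).2 hsum hr with h | h
    · left
      apply Subtype.ext; funext i
      revert i
      apply fin_ind
      · rw [h]; exact (xW_zero n K).symm
      · intro i hi
        rw [halt, hi]; exact (xW_succ n K i).symm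
    · right
      rw [← sS_sS n K D]
      congr 1
      apply Subtype.ext; funext i
      show (D.1 i).map (sg K) = xW n K i
      revert i
      apply fin_ind
      · rw [h]; exact (xW_zero n K).symm
      · intro i hi
        rw [halt, hi]; exact (xW_succ n K i).symm

theorem card_bridge (n K : ℕ) : Finite (Quotient (relS (sS n K) (sS_sS n K))) ∧
    numEquivClasses (2 ^ (n + 1)) (K + 2) (cF n K) =
      Nat.card (Quotient (relS (sS n K) (sS_sS n K))) := by
  choose F hF hR using fun G : {G // IsEquipartingMatrix (2 ^ (n + 1)) (K + 2) (cF n K) G} =>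
    exists_words G.2
  have wd : ∀ G G' : {G // IsEquipartingMatrix (2 ^ (n + 1)) (K + 2) (cF n K) G},
      EMEquiv (2 ^ (n + 1)) (K + 2) (cF n K) G.1 G'.1 →
      (relS (sS n K) (sS_sS n K)).r ⟨F G, hF G⟩ ⟨F G', hF G'⟩ := by
    rintro G G' ⟨β, τ, hτ, h⟩
    have : ∀ i, F G' i = (F G i).map τ.symm := fun i =>
      (hR G' i).unique ((hR G i).act β τ (h i))
    rcases stab n K τ hτ with rfl | rfl
    · left
      apply Subtype.ext; funext i
      exact (this i).trans (List.map_id _)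
    · right
      apply Subtype.ext; funext i
      have h2 := this i
      rwa [show (sg K).symm = sg K from Equiv.symm_swap _ _] at h2
  let Φ : (Quot fun G G' : {G // IsEquipartingMatrix (2 ^ (n + 1)) (K + 2) (cF n K) G} =>
      EMEquiv (2 ^ (n + 1)) (K + 2) (cF n K) G.1 G'.1) →
      Quotient (relS (sS n K) (sS_sS n K)) :=
    Quot.lift (fun G => Quotient.mk _ ⟨F G, hF G⟩) (fun G G' h => Quotient.sound (wd G G' h))
  have hb : Function.Bijective Φ := by
    constructor
    · intro x y
      induction x using Quot.ind with | _ G => ?_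
      induction y using Quot.ind with | _ G' => ?_
      intro h
      apply Quot.sound
      rcases (Quotient.exact h : (relS (sS n K) (sS_sS n K)).r _ _) with h | h
      · have h := congrArg Subtype.val h
        simp only at h
        refine equiv_of_words G.2 G'.2 (F G) (hR G) 1 (fun t => rfl) (fun i => ?_)
        have := hR G' i
        rw [h] at this
        exact (List.map_id (F G i)).symm ▸ this
      · have h := congrArg Subtype.val h
        simp only [sS] at h
        refine equiv_of_words G.2 G'.2 (F G) (hR G) (sg K) (cF_sg n K) (fun i => ?_)
        have := hR G' i
        rw [h] at this
        rw [show (sg K).symm = sg K from Equiv.symm_swap _ _]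
        exact this
    · intro y
      induction y using Quotient.ind with | _ D => ?_
      obtain ⟨G, hG, hGD⟩ := exists_matrix D.2
      refine ⟨Quot.mk _ ⟨G, hG⟩, ?_⟩
      show Quotient.mk _ _ = _
      congr 1
      apply Subtype.ext; funext i
      exact (hR ⟨G, hG⟩ i).unique (hGD i)
  exact ⟨Finite.of_surjective Φ hb.2, Nat.card_congr (Equiv.ofBijective Φ hb)⟩

end final

/-- For `k ≥ 2` and `j = 2^(n+1)`, the number of equivalence classes of
`(c 0, …, c (k-1))`-equiparting matrices is odd, where `c` (indexed by `Fin k`,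
so entry `i` of the 1-indexed tuple is `c ⟨i-1⟩`) is given by `cᵢ = 2^(n+1+i)` for
`1 ≤ i ≤ k-2` and `c_{k-1} = c_k = 2^(n+k-1) + 2^n`. -/
theorem odd_numEquivClasses_power_of_two (k n : ℕ) (hk : 2 ≤ k) :
    Odd (numEquivClasses (2 ^ (n + 1)) k
      (fun t => if t.val + 3 ≤ k then 2 ^ (n + 2 + t.val)
        else 2 ^ (n + k - 1) + 2 ^ n)) := by
  obtain ⟨K, rfl⟩ : ∃ K, k = K + 2 := ⟨k - 2, by omega⟩
  obtain ⟨h1, h2⟩ := card_bridge n K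
  have := odd_ST n K
  rw [← h2] at this
  exact this
end

section
/- Let k > 2 and n ≥ 1 be integers, let 0 ≤ r < 2^n and set j = 2^n + r (so j ≥ 2). Define w = min(r, 2^{n−1}) and s = r − w, and define (c_1,…,c_k) by c_i = 2^{i−1}·2^n + 2^i·w + 2^{i+1}·s for 1 ≤ i ≤ k−2, c_{k−1} = 2^{k−2}·2^n + 2^{k−1}·w + 2s, and c_k = 2^{k−1}·2^n + w + s. Then the number of equivalence classes of (c_1,…,c_k)-equiparting matrices is odd. -/
def GoodL {k : ℕ} (S : Finset (Fin k)) (L : List (Fin k)) : Prop :=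
  L.length = 2 ^ S.card - 1 ∧ (∀ a ∈ L, a ∈ S) ∧
    ∀ B, B <:+: L → B ≠ [] → ∃ t, Odd (B.count t)

theorem GoodL.rev {k : ℕ} {S : Finset (Fin k)} {L : List (Fin k)} (h : GoodL S L) :
    GoodL S L.reverse := by
  obtain ⟨h1, h2, h3⟩ := h
  refine ⟨by simpa using h1, by simpa using h2, ?_⟩
  intro B hB hne
  obtain ⟨t, ht⟩ := h3 B.reverse (by simpa using List.reverse_infix.mpr hB) (by simpa using hne)
  exact ⟨t, by simpa using ht⟩

theorem two_pow_aux {k : ℕ} {S : Finset (Fin k)} {m : Fin k} (hm : m ∈ S) :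
    2 ^ S.card - 1 = 2 * (2 ^ (S.erase m).card - 1) + 1 := by
  have h1 := Finset.card_erase_add_one hm
  rw [← h1, pow_succ]
  have : 0 < 2 ^ (S.erase m).card := by positivity
  omega

theorem GoodL.palin {k : ℕ} {S : Finset (Fin k)} {L : List (Fin k)} (hS : S.Nonempty)
    (h : GoodL S L) (hp : L.reverse = L) :
    ∃ m ∈ S, ∃ L', GoodL (S.erase m) L' ∧ L = L' ++ m :: L'.reverse := by
  obtain ⟨h1, h2, h3⟩ := h
  obtain ⟨x, hx⟩ := hS
  have hc := two_pow_aux hx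
  set q := 2 ^ (S.erase x).card - 1 with hq
  have hlen : L.length = 2 * q + 1 := by omega
  obtain ⟨m, rest, hr⟩ : ∃ m rest, L.drop q = m :: rest := by
    apply List.exists_cons_of_ne_nil
    intro h0
    have := congrArg List.length h0
    simp at this; omega
  have hL : L = L.take q ++ m :: rest := by rw [← hr, List.take_append_drop]
  have hlt : (L.take q).length = q := by simp; omega
  have hlr : rest.length = q := by
    have := congrArg List.length hr
    simp at this; omega
  set A := L.take q with hA
  have hrev : rest.reverse ++ m :: A.reverse = A ++ m :: rest := by
    have h5 := congrArg List.reverse hL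
    rw [hp] at h5
    rw [← hL, h5]; simp
  have hAr := (List.append_inj hrev (by simp [hlt, hlr])).1
  have hLL : L = A ++ m :: A.reverse := by rw [← hAr, List.reverse_reverse, hAr]; exact hL
  have hmS : m ∈ S := h2 m (by rw [hLL]; simp)
  have hmA : m ∉ A := by
    intro hm
    obtain ⟨s, t, hst, hmt⟩ := List.append_of_mem (a := m) (l := A.reverse) (by simpa using hm)
      |> fun _ => List.eq_append_cons_of_mem (a := m) (xs := A.reverse) (by simpa using hm)
    have hA2 : A = t.reverse ++ m :: s.reverse := by
      rw [← A.reverse_reverse, hst]; simp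
    obtain ⟨u, hu⟩ := h3 (m :: s.reverse ++ m :: s) ⟨t.reverse, m :: t, by
      rw [hLL, hst, hA2]; simp⟩ (by simp)
    rw [List.count_append, List.count_cons, List.count_cons, List.count_reverse] at hu
    exact (Nat.not_odd_iff_even.mpr ⟨_, rfl⟩) hu
  refine ⟨m, hmS, A, ⟨?_, ?_, ?_⟩, hLL⟩
  · rw [hlt, hq, Finset.card_erase_of_mem hx, Finset.card_erase_of_mem hmS]
  · intro a ha
    refine Finset.mem_erase.mpr ⟨fun h => hmA (h ▸ ha), h2 a (by rw [hLL]; simp [ha])⟩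
  · intro B hB
    exact h3 B (hB.trans (by rw [hLL]; exact (List.prefix_append _ _).isInfix))

theorem infix_mid {α : Type*} {A C B : List α} {m : α} (h : B <:+: A ++ m :: C) :
    B <:+: A ∨ B <:+: C ∨ ∃ A' C', A' <:+: A ∧ C' <:+: C ∧ B = A' ++ m :: C' := by
  obtain ⟨s, t, hst⟩ := h
  rw [List.append_assoc, List.append_eq_append_iff] at hst
  rcases hst with ⟨a, h1, h2⟩ | ⟨a, h1, h2⟩
  · rw [List.append_eq_append_iff] at h2
    rcases h2 with ⟨b, h3, h4⟩ | ⟨b, h3, h4⟩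
    · left; exact ⟨s, b, by rw [h1, h3]; simp⟩
    · rcases b with _ | ⟨y, b⟩
      · left; exact ⟨s, [], by rw [h1, h3]; simp⟩
      · right; right
        simp at h4
        refine ⟨a, b, ⟨s, [], by rw [h1]; simp⟩, ⟨[], t, by rw [h4.2]; simp⟩, ?_⟩
        rw [h3, h4.1]
  · rcases a with _ | ⟨y, a⟩
    · simp at h2
      rcases B with _ | ⟨z, B⟩
      · left; exact List.nil_infix
      · right; right
        simp at h2
        exact ⟨[], B, List.nil_infix, ⟨[], t, by rw [h2.2]; simp⟩, by rw [h2.1]; simp⟩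
    · right; left
      simp at h2
      exact ⟨a, t, by rw [h2.2]; simp⟩

theorem GoodL.mk_palin {k : ℕ} {S : Finset (Fin k)} {L : List (Fin k)} {m : Fin k} (hm : m ∈ S)
    (h : GoodL (S.erase m) L) : GoodL S (L ++ m :: L.reverse) := by
  have hr := h.rev
  obtain ⟨h1, h2, h3⟩ := h
  have hmL : m ∉ L := fun hh => by simpa using h2 m hh
  refine ⟨?_, ?_, ?_⟩
  · rw [two_pow_aux hm, ← h1]; simp; omega
  · intro a ha
    simp at ha
    by_cases hq : a = m
    · exact hq ▸ hm
    · exact Finset.mem_of_mem_erase (h2 a (by tauto))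
  · intro B hB hne
    rcases infix_mid hB with h | h | ⟨A', C', hA, hC, rfl⟩
    · exact h3 B h hne
    · exact hr.2.2 B h hne
    · refine ⟨m, ?_⟩
      have e1 : A'.count m = 0 := List.count_eq_zero.mpr fun h => hmL (hA.subset h)
      have e2 : C'.count m = 0 := List.count_eq_zero.mpr fun h => hmL (by simpa using hC.subset h)
      simp [e1, e2]

theorem goodL_finite {k : ℕ} (S : Finset (Fin k)) : {L | GoodL S L}.Finite :=
  (List.finite_length_eq (Fin k) (2 ^ S.card - 1)).subset fun _ h => h.1

noncomputable def goodF {k : ℕ} (S : Finset (Fin k)) : Finset (List (Fin k)) :=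
  (goodL_finite S).toFinset

theorem mem_goodF {k : ℕ} {S : Finset (Fin k)} {L : List (Fin k)} : L ∈ goodF S ↔ GoodL S L := by
  simp [goodF]

noncomputable def mon {k : ℕ} (L : List (Fin k)) : MvPolynomial (Fin k) (ZMod 2) :=
  (L.map MvPolynomial.X).prod

noncomputable def PP {k : ℕ} (S : Finset (Fin k)) : MvPolynomial (Fin k) (ZMod 2) :=
  ∑ L ∈ goodF S, mon L

theorem PP_rec {k : ℕ} {S : Finset (Fin k)} (hS : S.Nonempty) :
    PP S = ∑ m ∈ S, MvPolynomial.X m * PP (S.erase m) ^ 2 := by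
  classical
  have h0 : ∑ L ∈ (goodF S).filter (fun L => ¬ L.reverse = L), mon L = 0 := by
    refine Finset.sum_involution (fun L _ => L.reverse) ?_ ?_ ?_ ?_
    · intro a _
      have : mon a.reverse = mon a := by
        unfold mon; rw [List.map_reverse, List.prod_reverse]
      rw [this, CharTwo.add_self_eq_zero]
    · intro a ha _
      exact (Finset.mem_filter.mp ha).2
    · intro a ha
      rw [Finset.mem_filter, mem_goodF] at ha ⊢
      refine ⟨ha.1.rev, ?_⟩
      rw [List.reverse_reverse]; exact fun h => ha.2 h.symm
    · intro a _; simp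
  have e1 : ∀ m, PP (S.erase m) ^ 2 = ∑ L ∈ goodF (S.erase m), mon L ^ 2 := fun m =>
    sum_pow_char 2 _ _
  unfold PP at e1 ⊢
  rw [← Finset.sum_filter_add_sum_filter_not _ (fun L => L.reverse = L), h0, add_zero]
  simp_rw [e1, Finset.mul_sum]
  rw [Finset.sum_sigma']
  symm
  refine Finset.sum_bij (fun p _ => p.2 ++ p.1 :: p.2.reverse) ?_ ?_ ?_ ?_
  · rintro ⟨m, L⟩ h
    simp only [Finset.mem_sigma, mem_goodF] at h
    simp only [Finset.mem_filter, mem_goodF]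
    exact ⟨h.2.mk_palin h.1, by simp⟩
  · rintro ⟨m, L⟩ h ⟨m', L'⟩ h' he
    simp only [Finset.mem_sigma, mem_goodF] at h h'
    have hl : L.length = L'.length := by
      rw [h.2.1, h'.2.1, Finset.card_erase_of_mem h.1, Finset.card_erase_of_mem h'.1]
    have := List.append_inj he hl
    simp at this
    simp [this]
  · intro L hL
    simp only [Finset.mem_filter, mem_goodF] at hL
    obtain ⟨m, hm, L', h1, h2⟩ := hL.1.palin hS hL.2
    exact ⟨⟨m, L'⟩, by simp only [Finset.mem_sigma, mem_goodF]; exact ⟨hm, h1⟩, h2.symm⟩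
  · rintro ⟨m, L⟩ h
    simp [mon]; ring

theorem PP_empty {k : ℕ} : PP (∅ : Finset (Fin k)) = 1 := by
  have : goodF (∅ : Finset (Fin k)) = {[]} := by
    ext L
    rw [mem_goodF, Finset.mem_singleton]
    constructor
    · intro h; simpa using h.1
    · rintro rfl
      refine ⟨by simp, by simp, ?_⟩
      intro B hB h
      exact absurd (List.infix_nil.mp hB) h
  simp [PP, this, mon]

def EE {k : ℕ} (S : Finset (Fin k)) : Finset (Fin k → ℕ) :=
  (Fintype.piFinset fun a => if a ∈ S then Finset.range S.card else {0}).filter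
    (fun e => Set.InjOn e (S : Set (Fin k)))

theorem mem_EE {k : ℕ} {S : Finset (Fin k)} {e : Fin k → ℕ} : e ∈ EE S ↔
    (∀ a ∈ S, e a < S.card) ∧ (∀ a ∉ S, e a = 0) ∧ Set.InjOn e (S : Set (Fin k)) := by
  simp only [EE, Finset.mem_filter, Fintype.mem_piFinset]
  rw [← and_assoc]
  refine and_congr_left fun _ => ?_
  constructor
  · intro h
    exact ⟨fun a ha => by simpa [ha] using h a, fun a ha => by simpa [ha] using h a⟩
  · intro h a
    by_cases ha : a ∈ S
    · simpa [ha] using h.1 a ha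
    · simpa [ha] using h.2 a ha

theorem PP_eq {k : ℕ} (S : Finset (Fin k)) :
    PP S = ∑ e ∈ EE S, ∏ a ∈ S, (MvPolynomial.X a) ^ (2 ^ e a) := by
  classical
  induction' hc : S.card with d ih generalizing S
  · rw [Finset.card_eq_zero] at hc
    subst hc
    have : EE (∅ : Finset (Fin k)) = {fun _ => 0} := by
      ext e; rw [mem_EE]; simp [funext_iff]
    rw [PP_empty, this]; simp
  · have hS : S.Nonempty := by rw [← Finset.card_pos]; omega
    rw [PP_rec hS]
    have e1 : ∀ m ∈ S, MvPolynomial.X m * PP (S.erase m) ^ 2 = ∑ e ∈ EE (S.erase m),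
        (MvPolynomial.X m : MvPolynomial (Fin k) (ZMod 2)) *
          ∏ a ∈ S.erase m, (MvPolynomial.X a) ^ (2 ^ (e a + 1)) := by
      intro m hm
      rw [ih _ (by rw [Finset.card_erase_of_mem hm]; omega), sum_pow_char 2, Finset.mul_sum]
      simp_rw [← Finset.prod_pow, ← pow_mul, ← pow_succ]
    rw [Finset.sum_congr rfl e1, Finset.sum_sigma']
    refine Finset.sum_bij (fun p _ a => if a ∈ S.erase p.1 then p.2 a + 1 else 0) ?_ ?_ ?_ ?_
    · rintro ⟨m, e⟩ h
      simp only [Finset.mem_sigma, mem_EE] at h ⊢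
      obtain ⟨hm, h1, h2, h3⟩ := h
      have hcd := Finset.card_erase_add_one hm
      refine ⟨?_, ?_, ?_⟩
      · intro a ha
        split_ifs with hh
        · have := h1 a hh; omega
        · omega
      · intro a ha
        simp [ha]
      · intro a ha b hb hab
        simp only at hab
        split_ifs at hab with p q q
        · exact h3 p q (by omega)
        · simp at p q ha hb
          by_contra hne
          grind
    · rintro ⟨m, e⟩ h ⟨m', e'⟩ h' he
      simp only [Finset.mem_sigma, mem_EE] at h h'
      obtain ⟨hm, h1, h2, h3⟩ := h
      obtain ⟨hm', h1', h2', h3'⟩ := h'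
      have hmm : m = m' := by
        have := congrFun he m
        simp [hm] at this
        exact this
      subst hmm
      congr 1
      funext a
      have := congrFun he a
      simp only at this
      by_cases ha : a ∈ S.erase m
      · simpa [ha] using this
      · rw [h2 a ha, h2' a ha]
    · intro e he
      rw [mem_EE] at he
      obtain ⟨h1, h2, h3⟩ := he
      have him : S.image e = Finset.range S.card := by
        apply Finset.eq_of_subset_of_card_le
        · intro x hx
          obtain ⟨a, ha, rfl⟩ := Finset.mem_image.mp hx
          simpa using h1 a ha
        · rw [Finset.card_image_of_injOn h3]; simp
      obtain ⟨m, hm, hm0⟩ : ∃ m ∈ S, e m = 0 := by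
        have : 0 ∈ S.image e := by rw [him]; simp; omega
        simpa using this
      have hpos : ∀ a ∈ S, a ≠ m → 0 < e a := by
        intro a ha hne
        rcases Nat.eq_zero_or_pos (e a) with h | h
        · exact absurd (h3 ha hm (by rw [h, hm0])) hne
        · exact h
      have hcd := Finset.card_erase_add_one hm
      refine ⟨⟨m, fun a => e a - 1⟩, ?_, ?_⟩
      · simp only [Finset.mem_sigma, mem_EE]
        refine ⟨hm, ?_, ?_, ?_⟩
        · intro a ha
          simp at ha
          have := h1 a ha.2
          have := hpos a ha.2 ha.1
          omega
        · intro a ha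
          simp at ha
          by_cases hh : a = m
          · rw [hh, hm0]
          · rw [h2 a (ha hh)]
        · intro a ha b hb hab
          simp at ha hb hab
          have := hpos a ha.1 ha.2
          have := hpos b hb.1 hb.2
          exact h3 ha.1 hb.1 (by omega)
      · funext a
        simp only
        split_ifs with hh
        · simp at hh
          have := hpos a hh.2 hh.1
          omega
        · simp at hh
          by_cases hq : a = m
          · rw [hq, hm0]
          · rw [h2 a (hh hq)]
    · rintro ⟨m, e⟩ h
      simp only [Finset.mem_sigma, mem_EE] at h
      rw [← Finset.mul_prod_erase _ _ h.1]
      simp only [Finset.mem_erase, ne_eq, not_true_eq_false, false_and, if_false, pow_zero, pow_one]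
      congr 1
      refine Finset.prod_congr rfl fun a ha => ?_
      simp at ha
      simp [ha]

theorem low_bits (d : ℕ) : ∀ (n : ℕ) (B : Finset ℕ) (e : ℕ → ℕ), B.card = d → (∀ b ∈ B, b < n) →
    (∑ b ∈ B, 2 ^ (b + e b)) ≡ (∑ b ∈ B, 2 ^ b) [MOD 2 ^ n] → ∀ b ∈ B, e b = 0 := by
  induction d with
  | zero =>
    intro n B e hc
    rw [Finset.card_eq_zero] at hc
    subst hc; simp
  | succ d ih =>
    intro n B e hc hB h
    have hne : B.Nonempty := by rw [← Finset.card_pos]; omega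
    set m := B.min' hne with hm
    have hmB : m ∈ B := B.min'_mem hne
    have hmin : ∀ b ∈ B.erase m, m + 1 ≤ b := by
      intro b hb
      rw [Finset.mem_erase] at hb
      have := B.min'_le b hb.2
      omega
    have h1 : (∑ b ∈ B.erase m, 2 ^ (b + e b)) ≡ 0 [MOD 2 ^ (m + 1)] := by
      rw [Nat.modEq_zero_iff_dvd]
      exact Finset.dvd_sum fun b hb => pow_dvd_pow _ (by have := hmin b hb; omega)
    have h2 : (∑ b ∈ B.erase m, 2 ^ b) ≡ 0 [MOD 2 ^ (m + 1)] := by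
      rw [Nat.modEq_zero_iff_dvd]
      exact Finset.dvd_sum fun b hb => pow_dvd_pow _ (by have := hmin b hb; omega)
    have hem : e m = 0 := by
      by_contra h0
      have h3 := h.of_dvd (pow_dvd_pow 2 (show m + 1 ≤ n from hB m hmB))
      rw [← Finset.add_sum_erase _ _ hmB, ← Finset.add_sum_erase _ _ hmB] at h3
      have h4 : 2 ^ (m + e m) + 0 ≡ 2 ^ m + 0 [MOD 2 ^ (m + 1)] :=
        ((Nat.ModEq.rfl.add h1).symm.trans h3).trans (Nat.ModEq.rfl.add h2)
      have h5 : 2 ^ (m + e m) ≡ 0 [MOD 2 ^ (m + 1)] := by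
        rw [Nat.modEq_zero_iff_dvd]; exact pow_dvd_pow _ (by omega)
      have h6 : 2 ^ m ≡ 0 [MOD 2 ^ (m + 1)] := (by simpa using h4.symm : _ ≡ _ [MOD _]).trans h5
      rw [Nat.modEq_zero_iff_dvd, Nat.pow_dvd_pow_iff_le_right (by norm_num)] at h6
      omega
    intro b hb
    by_cases hbm : b = m
    · rw [hbm, hem]
    · refine ih n (B.erase m) e (by rw [Finset.card_erase_of_mem hmB]; omega)
        (fun b hb => hB b (Finset.mem_of_mem_erase hb)) ?_ b (Finset.mem_erase.mpr ⟨hbm, hb⟩)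
      rw [← Finset.add_sum_erase _ _ hmB, ← Finset.add_sum_erase _ _ hmB, hem, add_zero] at h
      exact Nat.ModEq.add_left_cancel' _ h

/-- the distinguished exponent functions -/
def phi0 {k : ℕ} (n : ℕ) (W : Finset ℕ) (b : ℕ) (t : Fin k) : ℕ :=
  if b = n then t.val
  else if b ∈ W then (if t.val + 1 < k then t.val + 1 else 0)
  else if t.val + 3 ≤ k then t.val + 2 else if t.val + 2 = k then 1 else 0

theorem uniq {k n : ℕ} (hk : 2 < k) (W T : Finset ℕ) (hW : ∀ b ∈ W, b < n) (hT : ∀ b ∈ T, b < n)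
    (hWT : Disjoint W T) (hor : T = ∅ ∨ (W = {n - 1} ∧ 1 ≤ n))
    (φ : ℕ → Fin k → ℕ) (hinj : ∀ b ∈ insert n (W ∪ T), Function.Injective (φ b))
    (hlt : ∀ b ∈ insert n (W ∪ T), ∀ t, φ b t < k)
    (hsum : ∀ t, ∑ b ∈ insert n (W ∪ T), 2 ^ (b + φ b t) =
      ∑ b ∈ insert n (W ∪ T), 2 ^ (b + phi0 n W b t)) :
    ∀ b ∈ insert n (W ∪ T), φ b = phi0 n W b := by
  have hB : ∀ b ∈ W ∪ T, b < n := by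
    intro b hb; rcases Finset.mem_union.mp hb with h | h
    exacts [hW b h, hT b h]
  have hnB : n ∉ W ∪ T := fun h => lt_irrefl _ (hB n h)
  -- the general maximality step
  have step : ∀ t : Fin k, (∀ b ∈ insert n (W ∪ T), φ b t ≤ phi0 n W b t) →
      ∀ b ∈ insert n (W ∪ T), φ b t = phi0 n W b t := by
    intro t hle b hb
    have := (Finset.sum_eq_sum_iff_of_le (fun b hb =>
      Nat.pow_le_pow_right (show 0 < 2 by norm_num) (Nat.add_le_add_left (hle b hb) b))).mp
      (hsum t) b hb
    have := Nat.pow_right_injective (le_refl 2) this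
    omega
  -- maximality from the values at larger coordinates
  have step2 : ∀ t : Fin k, (∀ u : Fin k, t < u → ∀ b ∈ insert n (W ∪ T), φ b u = phi0 n W b u) →
      (∀ b ∈ insert n (W ∪ T), ∀ v, phi0 n W b t < v → v < k → ∃ u : Fin k, t < u ∧ phi0 n W b u = v) →
      ∀ b ∈ insert n (W ∪ T), φ b t = phi0 n W b t := by
    intro t h1 h2
    apply step
    intro b hb
    by_contra hcon
    push Not at hcon
    obtain ⟨u, hu, hv⟩ := h2 b hb _ hcon (hlt b hb t)
    rw [← h1 u hu b hb] at hv
    exact absurd (hinj b hb hv) (ne_of_gt hu)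
  -- last coordinate
  have last : ∀ t : Fin k, t.val + 1 = k → ∀ b ∈ insert n (W ∪ T), φ b t = phi0 n W b t := by
    intro t ht
    have hz : ∀ b ∈ W ∪ T, phi0 n W b t = 0 := by
      intro b hb
      have := hB b hb
      unfold phi0
      split_ifs <;> omega
    have hs := hsum t
    rw [Finset.sum_insert hnB, Finset.sum_insert hnB] at hs
    have hs2 : ∑ b ∈ W ∪ T, 2 ^ (b + phi0 n W b t) = ∑ b ∈ W ∪ T, 2 ^ b :=
      Finset.sum_congr rfl fun b hb => by rw [hz b hb, add_zero]
    have h0 := low_bits _ n (W ∪ T) (fun b => φ b t) rfl hB (by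
      have e1 : ∀ x, 2 ^ (n + x) ≡ 0 [MOD 2 ^ n] := fun x => by
        rw [Nat.modEq_zero_iff_dvd]; exact pow_dvd_pow _ (by omega)
      have := congrArg (· % 2 ^ n) hs
      have h7 : _ ≡ _ [MOD 2 ^ n] := this
      have h8 := ((e1 (φ n t)).trans (e1 (phi0 n W n t)).symm).add_left_cancel h7
      rwa [hs2] at h8)
    apply step
    intro b hb
    rcases Finset.mem_insert.mp hb with rfl | hb'
    · have := hlt b hb t
      simp [phi0]; omega
    · simp [h0 b hb']
  have pre : ∀ t : Fin k, t.val + 2 = k → ∀ b ∈ insert n (W ∪ T), φ b t = phi0 n W b t := by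
    intro t ht
    have hl : ∀ u : Fin k, t < u → u.val + 1 = k := fun u hu => by
      have : t.val < u.val := hu
      have := u.isLt
      omega
    have hu0 : ∃ u : Fin k, t < u ∧ u.val + 1 = k := ⟨⟨k - 1, by omega⟩, by
      show t.val < k - 1
      omega, by simp; omega⟩
    rcases hor with rfl | ⟨rfl, hn⟩
    · apply step2 t (fun u hu => last u (hl u hu))
      intro b hb v hv hvk
      obtain ⟨u, hu, huk⟩ := hu0
      refine ⟨u, hu, ?_⟩
      simp only [Finset.union_empty, Finset.mem_insert] at hb
      unfold phi0 at hv ⊢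
      split_ifs at hv ⊢ <;> first | omega | tauto
    · obtain ⟨u, hu, huk⟩ := hu0
      have hpos : ∀ b ∈ {n - 1} ∪ T, 1 ≤ φ b t := by
        intro b hb
        have hb' := Finset.mem_insert_of_mem (b := n) hb
        rcases Nat.eq_zero_or_pos (φ b t) with h | h
        · have hlu := last u huk b hb'
          have : phi0 n {n - 1} b u = 0 := by
            have := hB b hb
            unfold phi0
            split_ifs <;> omega
          exact absurd (hinj b hb' (h.trans (hlu.trans this).symm)) (ne_of_lt hu)
        · exact h
      have hnt : φ n t ≤ k - 2 := by
        have hb' := Finset.mem_insert_self n ({n - 1} ∪ T)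
        have h1 := hlt n hb' t
        have hlu := last u huk n hb'
        have h2 : φ n t ≠ φ n u := fun h => absurd (hinj n hb' h) (ne_of_lt hu)
        simp [phi0] at hlu
        omega
      have hnT : n - 1 ∉ T := fun h => (Finset.disjoint_left.mp hWT) (by simp) h
      have hTlt : ∀ b ∈ T, b < n - 1 := by
        intro b hb
        have := hT b hb
        have : b ≠ n - 1 := fun h => hnT (h ▸ hb)
        omega
      have hs := hsum t
      rw [Finset.sum_insert hnB, Finset.sum_insert hnB, Finset.sum_union hWT, Finset.sum_union hWT,
        Finset.sum_singleton, Finset.sum_singleton] at hs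
      have p1 : ∀ b ∈ T, phi0 n {n - 1} b t = 1 := by
        intro b hb
        have := hTlt b hb
        unfold phi0
        have h9 : b ∉ ({n - 1} : Finset ℕ) := by simp; omega
        rw [if_neg (by omega), if_neg h9, if_neg (by omega), if_pos ht]
      have hs2 : ∑ b ∈ T, 2 ^ (b + phi0 n {n - 1} b t) = 2 * ∑ b ∈ T, 2 ^ b := by
        rw [Finset.mul_sum]
        exact Finset.sum_congr rfl fun b hb => by rw [p1 b hb]; ring
      have hs3 : ∑ b ∈ T, 2 ^ (b + φ b t) = 2 * ∑ b ∈ T, 2 ^ (b + (φ b t - 1)) := by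
        rw [Finset.mul_sum]
        refine Finset.sum_congr rfl fun b hb => ?_
        have := hpos b (by simp [hb])
        rw [← pow_succ']; congr 1; omega
      have h0 := low_bits _ (n - 1) T (fun b => φ b t - 1) rfl hTlt (by
        have e1 : ∀ x, n ≤ x → 2 ^ x ≡ 0 [MOD 2 ^ n] := fun x hx => by
          rw [Nat.modEq_zero_iff_dvd]; exact pow_dvd_pow _ (by omega)
        have h7 : _ ≡ _ [MOD 2 ^ n] := congrArg (· % 2 ^ n) hs
        have a1 := (e1 (n + φ n t) (by omega)).add (e1 (n - 1 + φ (n - 1) t) (by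
          have := hpos (n - 1) (by simp)
          omega))
        have a2 := (e1 (n + phi0 n {n - 1} n t) (by omega)).add
          (e1 (n - 1 + phi0 n {n - 1} (n - 1) t) (by
            have : phi0 n {n - 1} (n - 1) t = t.val + 1 := by
              unfold phi0
              rw [if_neg (by omega), if_pos (by simp), if_pos (by omega)]
            omega))
        rw [← add_assoc, ← add_assoc] at h7
        have h8 := (a1.trans a2.symm).add_left_cancel h7
        rw [hs2, hs3] at h8
        have hn2 : 2 ^ n = 2 * 2 ^ (n - 1) := by rw [← pow_succ']; congr 1; omega
        rw [hn2] at h8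
        exact Nat.ModEq.mul_left_cancel' (by norm_num) h8)
      apply step
      intro b hb
      rcases Finset.mem_insert.mp hb with rfl | hb'
      · simp [phi0]; omega
      · have h1 := hlt b hb t
        have h2 := hpos b hb'
        rcases Finset.mem_union.mp hb' with h | h
        · unfold phi0
          simp only [Finset.mem_singleton] at h
          rw [if_neg (by omega), if_pos (by simp [h]), if_pos (by omega)]
          omega
        · rw [p1 b h]
          have := h0 b h
          omega
  have main : ∀ d, ∀ t : Fin k, t.val + d = k → ∀ b ∈ insert n (W ∪ T), φ b t = phi0 n W b t := by
    intro d
    induction d using Nat.strong_induction_on with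
    | _ d ih =>
      intro t ht
      by_cases hd1 : d = 1
      · exact last t (by omega)
      by_cases hd2 : d = 2
      · exact pre t (by omega)
      have := t.isLt
      apply step2 t
      · intro u hu
        have : t.val < u.val := hu
        have := u.isLt
        exact ih (k - u.val) (by omega) u (by omega)
      · intro b hb v hv hvk
        by_cases hbn : b = n
        · refine ⟨⟨v, hvk⟩, ?_, ?_⟩
          · show t.val < v
            simpa [phi0, hbn] using hv
          · simp [phi0, hbn]
        · by_cases hbW : b ∈ W
          · simp only [phi0, hbn, hbW, if_true, if_false] at hv ⊢
            rw [if_pos (by omega)] at hv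
            exact ⟨⟨v - 1, by omega⟩, show t.val < v - 1 by omega, by
              simp only; rw [if_pos (by omega)]; omega⟩
          · simp only [phi0, hbn, hbW, if_false] at hv ⊢
            rw [if_pos (by omega)] at hv
            exact ⟨⟨v - 2, by omega⟩, show t.val < v - 2 by omega, by
              simp only; rw [if_pos (by omega)]; omega⟩
  intro b hb
  funext t
  exact main (k - t.val) t (by have := t.isLt; omega) b hb

theorem phi0_lt {k : ℕ} (hk : 2 < k) (n : ℕ) (W : Finset ℕ) (b : ℕ) (t : Fin k) :
    phi0 n W b t < k := by
  have := t.isLt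
  unfold phi0; split_ifs <;> omega

theorem phi0_inj {k : ℕ} (n : ℕ) (W : Finset ℕ) (b : ℕ) :
    Function.Injective (phi0 n W b : Fin k → ℕ) := by
  intro t u h
  have := t.isLt
  have := u.isLt
  ext
  unfold phi0 at h
  split_ifs at h <;> omega

theorem binrep : ∀ (n r : ℕ), r < 2 ^ n → ∃ B : Finset ℕ, (∀ b ∈ B, b < n) ∧ ∑ b ∈ B, 2 ^ b = r := by
  intro n
  induction n with
  | zero => intro r hr; exact ⟨∅, by simp, by simp at hr ⊢; omega⟩
  | succ n ih =>
    intro r hr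
    rw [pow_succ] at hr
    by_cases h : r < 2 ^ n
    · obtain ⟨B, h1, h2⟩ := ih r h
      exact ⟨B, fun b hb => by have := h1 b hb; omega, h2⟩
    · obtain ⟨B, h1, h2⟩ := ih (r - 2 ^ n) (by omega)
      have hn : n ∉ B := fun h => lt_irrefl _ (h1 n h)
      refine ⟨insert n B, ?_, ?_⟩
      · intro b hb
        rcases Finset.mem_insert.mp hb with rfl | h
        · omega
        · have := h1 b h; omega
      · rw [Finset.sum_insert hn, h2]; omega

theorem setup (n r : ℕ) (hn : 1 ≤ n) (hr : r < 2 ^ n) : ∃ W T : Finset ℕ,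
    (∀ b ∈ W, b < n) ∧ (∀ b ∈ T, b < n) ∧ Disjoint W T ∧ (T = ∅ ∨ (W = {n - 1} ∧ 1 ≤ n)) ∧
    ∑ b ∈ W, 2 ^ b = min r (2 ^ (n - 1)) ∧ ∑ b ∈ T, 2 ^ b = r - min r (2 ^ (n - 1)) := by
  by_cases h : r < 2 ^ (n - 1)
  · obtain ⟨B, h1, h2⟩ := binrep n r hr
    exact ⟨B, ∅, h1, by simp, by simp, Or.inl rfl, by rw [h2]; omega, by simp; omega⟩
  · have hn2 : 2 ^ n = 2 * 2 ^ (n - 1) := by rw [← pow_succ']; congr 1; omega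
    obtain ⟨B, h1, h2⟩ := binrep (n - 1) (r - 2 ^ (n - 1)) (by omega)
    refine ⟨{n - 1}, B, by simp; omega, fun b hb => by have := h1 b hb; omega, ?_,
      Or.inr ⟨rfl, hn⟩, by simp; omega, by rw [h2]; omega⟩
    rw [Finset.disjoint_singleton_left]
    intro h; exact lt_irrefl _ (h1 _ h)

theorem phi0_sum {k n : ℕ} (hk : 2 < k) (W T : Finset ℕ) (hW : ∀ b ∈ W, b < n)
    (hT : ∀ b ∈ T, b < n) (hWT : Disjoint W T) (t : Fin k) :
    ∑ b ∈ insert n (W ∪ T), 2 ^ (b + phi0 n W b t) =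
      if t.val + 3 ≤ k then
          2 ^ t.val * 2 ^ n + 2 ^ (t.val + 1) * (∑ b ∈ W, 2 ^ b) + 2 ^ (t.val + 2) * (∑ b ∈ T, 2 ^ b)
        else if t.val + 2 = k then
          2 ^ (k - 2) * 2 ^ n + 2 ^ (k - 1) * (∑ b ∈ W, 2 ^ b) + 2 * (∑ b ∈ T, 2 ^ b)
        else
          2 ^ (k - 1) * 2 ^ n + (∑ b ∈ W, 2 ^ b) + (∑ b ∈ T, 2 ^ b) := by
  have hnB : n ∉ W ∪ T := by
    intro h; rcases Finset.mem_union.mp h with h | h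
    exacts [lt_irrefl _ (hW n h), lt_irrefl _ (hT n h)]
  rw [Finset.sum_insert hnB, Finset.sum_union hWT]
  have eW : ∑ b ∈ W, 2 ^ (b + phi0 n W b t) =
      2 ^ (if t.val + 1 < k then t.val + 1 else 0) * ∑ b ∈ W, 2 ^ b := by
    rw [Finset.mul_sum]
    refine Finset.sum_congr rfl fun b hb => ?_
    have := hW b hb
    rw [phi0, if_neg (by omega), if_pos hb, pow_add, mul_comm]
  have eT : ∑ b ∈ T, 2 ^ (b + phi0 n W b t) =
      2 ^ (if t.val + 3 ≤ k then t.val + 2 else if t.val + 2 = k then 1 else 0) *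
        ∑ b ∈ T, 2 ^ b := by
    rw [Finset.mul_sum]
    refine Finset.sum_congr rfl fun b hb => ?_
    have := hT b hb
    have h2 : b ∉ W := fun h => (Finset.disjoint_left.mp hWT) h hb
    rw [phi0, if_neg (by omega), if_neg h2, pow_add, mul_comm]
  rw [eW, eT, phi0, if_pos rfl, pow_add, mul_comm (2 ^ n)]
  have := t.isLt
  by_cases h1 : t.val + 3 ≤ k
  · simp only [h1, if_true]
    rw [if_pos (by omega)]; ring
  · by_cases h2 : t.val + 2 = k
    · rw [if_pos (by omega), if_neg h1, if_pos h2, if_neg h1, if_pos h2,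
        show t.val + 1 = k - 1 by omega, show t.val = k - 2 by omega]; ring
    · rw [if_neg (by omega), if_neg h1, if_neg h2, if_neg h1, if_neg h2,
        show t.val = k - 1 by omega]; ring

theorem mon_eq {k : ℕ} (L : List (Fin k)) :
    mon L = MvPolynomial.monomial (Finsupp.equivFunOnFinite.symm fun t => L.count t) 1 := by
  induction L with
  | nil =>
    have : (Finsupp.equivFunOnFinite.symm fun t => ([] : List (Fin k)).count t) = 0 := by
      ext; simp
    rw [this]; simp [mon]
  | cons a L ih =>
    have h1 : mon (a :: L) = MvPolynomial.X a * mon L := by simp [mon]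
    rw [h1, ih, MvPolynomial.X, MvPolynomial.monomial_mul, one_mul]
    congr 2
    apply Finsupp.ext
    intro t
    simp [List.count_cons, Finsupp.single_apply, add_comm]

theorem mon_prod {ι : Type*} [Fintype ι] {k : ℕ} (s : ι → Fin k →₀ ℕ) :
    ∏ i, MvPolynomial.monomial (R := ZMod 2) (s i) 1 = MvPolynomial.monomial (∑ i, s i) 1 := by
  rw [MvPolynomial.monomial_sum_one]

theorem coeff_count {k : ℕ} (j : ℕ) (c : Fin k → ℕ) :
    MvPolynomial.coeff (Finsupp.equivFunOnFinite.symm c) (PP (Finset.univ : Finset (Fin k)) ^ j) =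
      ((((Fintype.piFinset fun _ : Fin j => goodF (Finset.univ : Finset (Fin k))).filter
        fun f => ∀ t, ∑ i, (f i).count t = c t).card : ℕ) : ZMod 2) := by
  classical
  have h1 : PP (Finset.univ : Finset (Fin k)) ^ j = ∏ _i : Fin j, PP Finset.univ := by simp
  rw [h1]
  unfold PP
  rw [Finset.prod_univ_sum, MvPolynomial.coeff_sum, Finset.card_filter, Nat.cast_sum]
  refine Finset.sum_congr rfl fun f _ => ?_
  simp_rw [mon_eq]
  rw [mon_prod, MvPolynomial.coeff_monomial]
  have : (∑ i, Finsupp.equivFunOnFinite.symm fun t => (f i).count t) =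
      Finsupp.equivFunOnFinite.symm c ↔ ∀ t, ∑ i, (f i).count t = c t := by
    rw [Finsupp.ext_iff]; simp
  simp only [this]
  push_cast
  rfl

theorem PP_pow {k : ℕ} (b : ℕ) : PP (Finset.univ : Finset (Fin k)) ^ (2 ^ b) =
    ∑ e ∈ EE (Finset.univ : Finset (Fin k)),
      MvPolynomial.monomial (Finsupp.equivFunOnFinite.symm fun t => 2 ^ (b + e t)) 1 := by
  rw [PP_eq, sum_pow_char_pow]
  refine Finset.sum_congr rfl fun e _ => ?_
  rw [MvPolynomial.monomial_eq, Finsupp.prod_fintype _ _ (by simp), ← Finset.prod_pow]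
  simp only [map_one, one_mul]
  refine Finset.prod_congr rfl fun a _ => ?_
  rw [← pow_mul, ← pow_add, add_comm]; simp

theorem mem_EE_univ {k : ℕ} {e : Fin k → ℕ} : e ∈ EE (Finset.univ : Finset (Fin k)) ↔
    (∀ a, e a < k) ∧ Function.Injective e := by
  rw [mem_EE]; simp

theorem coeff_one {k n : ℕ} (hk : 2 < k) (W T : Finset ℕ) (hW : ∀ b ∈ W, b < n)
    (hT : ∀ b ∈ T, b < n)
    (hWT : Disjoint W T) (hor : T = ∅ ∨ (W = {n - 1} ∧ 1 ≤ n)) (c : Fin k → ℕ)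
    (hc : ∀ t, c t = ∑ b ∈ insert n (W ∪ T), 2 ^ (b + phi0 n W b t)) :
    MvPolynomial.coeff (Finsupp.equivFunOnFinite.symm c)
      (PP (Finset.univ : Finset (Fin k)) ^ (∑ b ∈ insert n (W ∪ T), 2 ^ b)) = 1 := by
  classical
  rw [← Finset.prod_pow_eq_pow_sum, ← Finset.prod_coe_sort]
  simp_rw [PP_pow]
  rw [Finset.prod_univ_sum, MvPolynomial.coeff_sum]
  simp_rw [mon_prod, MvPolynomial.coeff_monomial]
  have key : ∀ φ : (insert n (W ∪ T) : Finset ℕ) → Fin k → ℕ,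
      (∑ i, Finsupp.equivFunOnFinite.symm fun t => 2 ^ (i.1 + φ i t)) =
      Finsupp.equivFunOnFinite.symm c ↔ ∀ t, ∑ i, 2 ^ (i.1 + φ i t) = c t := by
    intro φ; rw [Finsupp.ext_iff]; simp
  simp only [key]
  rw [Finset.sum_eq_single (fun b => phi0 n W b.1)]
  · rw [if_pos]
    intro t
    rw [hc, ← Finset.sum_coe_sort (insert n (W ∪ T)) (fun b => 2 ^ (b + phi0 n W b t))]
  · intro φ hφ hne
    rw [if_neg]
    intro hs
    apply hne
    simp only [Fintype.mem_piFinset, mem_EE_univ] at hφ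
    have hu := uniq hk W T hW hT hWT hor
      (fun b => if h : b ∈ insert n (W ∪ T) then φ ⟨b, h⟩ else 0) ?_ ?_ ?_
    · funext b
      have := hu b.1 b.2
      simpa using this
    · intro b hb
      simpa [hb] using (hφ ⟨b, hb⟩).2
    · intro b hb
      simpa only [hb, dif_pos] using (hφ ⟨b, hb⟩).1
    · intro t
      rw [← hc, ← hs t, ← Finset.sum_coe_sort]
      refine Finset.sum_congr rfl fun b _ => ?_
      rw [dif_pos b.2]
  · intro h
    exfalso; apply h
    simp only [Fintype.mem_piFinset, mem_EE_univ]
    exact fun b => ⟨phi0_lt hk n W b, phi0_inj n W b⟩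

theorem stab_trivial {k n : ℕ} (hk : 2 < k) (W T : Finset ℕ) (hW : ∀ b ∈ W, b < n)
    (hT : ∀ b ∈ T, b < n)
    (hWT : Disjoint W T) (hor : T = ∅ ∨ (W = {n - 1} ∧ 1 ≤ n)) (c : Fin k → ℕ)
    (hc : ∀ t, c t = ∑ b ∈ insert n (W ∪ T), 2 ^ (b + phi0 n W b t))
    (τ : Equiv.Perm (Fin k)) (hτ : ∀ t, c (τ t) = c t) : ∀ t, τ t = t := by
  have hu := uniq hk W T hW hT hWT hor (fun b t => phi0 n W b (τ t))
    (fun b _ => (phi0_inj n W b).comp τ.injective) (fun b _ t => phi0_lt hk n W b _)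
    (fun t => by rw [← hc, ← hc, hτ]) n (by simp)
  intro t
  exact phi0_inj n W n (congrFun hu t)

theorem odd_add_xor (x y : ℕ) :
    decide (Odd (x + y)) = xor (decide (Odd x)) (decide (Odd y)) := by
  by_cases hx : Odd x <;> by_cases hy : Odd y <;> simp [Nat.odd_add, hx, hy]
  · exact Nat.not_odd_iff_even.mp hy

theorem count_ofFn' {m k : ℕ} (D : Fin m → Fin k) (t : Fin k) :
    (List.ofFn D).count t = (Finset.univ.filter fun i => D i = t).card := by
  induction m with
  | zero => simp
  | succ m ih =>
    rw [List.ofFn_succ, List.count_cons, ih, Finset.card_filter, Finset.card_filter,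
      Fin.sum_univ_succ, add_comm]
    simp

theorem delta_exists {k : ℕ} {g : Fin (2 ^ k) → Fin k → Bool} (hg : IsGrayCode k g) :
    ∃ D, IsDeltaOf k g D := by
  choose D hD using hg.2
  refine ⟨D, fun i t => ⟨fun h => (hD i).2 t h, ?_⟩⟩
  rintro rfl
  exact (hD i).1

theorem delta_unique {k : ℕ} {g : Fin (2 ^ k) → Fin k → Bool} {D D'} (h : IsDeltaOf k g D)
    (h' : IsDeltaOf k g D') : D = D' := by
  funext i
  exact (h' i _).mp ((h i _).mpr rfl)

theorem delta_count {k : ℕ} {g : Fin (2 ^ k) → Fin k → Bool} {D} (h : IsDeltaOf k g D)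
    (t : Fin k) : grayTransCount k g t = (List.ofFn D).count t := by
  rw [count_ofFn', grayTransCount]
  congr 1
  ext i
  simp only [Finset.mem_filter, Finset.mem_univ, true_and]
  rw [h i t, eq_comm]

theorem delta_key {k : ℕ} {g : Fin (2 ^ k) → Fin k → Bool} {D} (h : IsDeltaOf k g D)
    (t : Fin k) (h0 : 0 < 2 ^ k) : ∀ m (hm : m < 2 ^ k), g ⟨m, hm⟩ t =
      xor (g ⟨0, h0⟩ t) (decide (Odd (((List.ofFn D).take m).count t))) := by
  intro m
  induction m with
  | zero => intro hm; simp
  | succ m ih =>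
    intro hm
    have ih' := ih (by omega)
    have hp : m < (List.ofFn D).length := by simp; omega
    rw [List.take_succ_eq_append_getElem hp, List.count_append, List.getElem_ofFn]
    have hd := h ⟨m, by omega⟩ t
    simp only [finLo, finHi] at hd
    by_cases hq : t = D ⟨m, by omega⟩
    · have h1 := hd.mpr hq
      rw [← hq]
      simp only [List.count_singleton_self]
      rw [ih'] at h1
      have : decide (Odd (List.count t ((List.ofFn D).take m) + 1)) =
          !decide (Odd (List.count t ((List.ofFn D).take m))) := by
        rw [← decide_not]; simp [Nat.odd_add_one]
      rw [this]
      revert h1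
      generalize decide (Odd (List.count t ((List.ofFn D).take m))) = x
      generalize g ⟨0, h0⟩ t = y
      generalize g ⟨m + 1, hm⟩ t = z
      revert x y z; decide
    · have h1 : ¬ _ := fun hh => hq (hd.mp hh)
      push Not at h1
      rw [← h1, ih', List.count_singleton, if_neg (by simpa using fun h => hq h.symm), add_zero]

theorem delta_good {k : ℕ} {g : Fin (2 ^ k) → Fin k → Bool} {D} (hg : IsGrayCode k g)
    (h : IsDeltaOf k g D) : GoodL Finset.univ (List.ofFn D) := by
  refine ⟨by simp, by simp, ?_⟩
  intro B hB hne
  obtain ⟨A, C, hL⟩ := hB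
  have hlen := congrArg List.length hL
  simp only [List.length_append, List.length_ofFn] at hlen
  have hBpos : 0 < B.length := List.length_pos_iff.mpr hne
  have h0 : 0 < 2 ^ k := by positivity
  by_contra hcon
  push Not at hcon
  have : (⟨A.length, by omega⟩ : Fin (2 ^ k)) = ⟨A.length + B.length, by omega⟩ := by
    apply hg.1.1
    funext t
    rw [delta_key h t h0 A.length, delta_key h t h0 (A.length + B.length), ← hL]
    have e1 : (A ++ B ++ C).take A.length = A := by simp
    have e2 : (A ++ B ++ C).take (A.length + B.length) = A ++ B := by
      rw [← List.length_append, List.take_left]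
    rw [e1, e2, List.count_append]
    congr 2
    have := hcon t
    rw [Nat.not_odd_iff_even] at this
    rw [Nat.odd_add]
    simp [this]
  have := congrArg Fin.val this
  simp only at this
  omega

def gg {k : ℕ} (v : Fin k → Bool) (L : List (Fin k)) : Fin (2 ^ k) → Fin k → Bool :=
  fun m t => xor (v t) (decide (Odd ((L.take m.val).count t)))

theorem gg_delta {k : ℕ} (v : Fin k → Bool) (L : List (Fin k)) (hL : L.length = 2 ^ k - 1) :
    IsDeltaOf k (gg v L) (fun p => L[p.val]'(by rw [hL]; exact p.2)) := by
  intro p t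
  have hp : p.val < L.length := by rw [hL]; exact p.2
  show (xor (v t) (decide (Odd ((L.take p.val).count t))) ≠
    xor (v t) (decide (Odd ((L.take (p.val + 1)).count t)))) ↔ _
  rw [List.take_succ_eq_append_getElem hp, List.count_append]
  by_cases hq : t = L[p.val]
  · simp only [← hq, List.count_singleton_self, iff_true]
    have : decide (Odd (List.count t (L.take p.val) + 1)) =
          !decide (Odd (List.count t (L.take p.val))) := by
        rw [← decide_not]; simp [Nat.odd_add_one]
    rw [this]
    simp
  · simp only [hq, iff_false]
    rw [List.count_singleton, if_neg (by simpa using fun h => hq h.symm)]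
    simp

theorem gg_gray {k : ℕ} (v : Fin k → Bool) (L : List (Fin k)) (hL : GoodL Finset.univ L) :
    IsGrayCode k (gg v L) := by
  have hlen : L.length = 2 ^ k - 1 := by simpa using hL.1
  have h0 : 0 < 2 ^ k := by positivity
  have hd := gg_delta v L hlen
  refine ⟨?_, fun i => ⟨_, (hd i _).mpr rfl, fun t ht => (hd i t).mp ht⟩⟩
  rw [Fintype.bijective_iff_injective_and_card]
  refine ⟨?_, by simp⟩
  have main : ∀ a b : Fin (2 ^ k), a.val < b.val → gg v L a ≠ gg v L b := by
    intro a b hab he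
    have hb := b.isLt
    have hdec : L.take b.val = L.take a.val ++ (L.take b.val).drop a.val := by
      have := List.take_append_drop a.val (L.take b.val)
      rw [List.take_take, min_eq_left hab.le] at this
      exact this.symm
    have hinf : (L.take b.val).drop a.val <:+: L :=
      (List.drop_suffix _ _).isInfix.trans (List.take_prefix _ _).isInfix
    obtain ⟨t, ht⟩ := hL.2.2 _ hinf (by
      intro hh
      have := congrArg List.length hh
      simp at this
      omega)
    have h1 := congrFun he t
    simp only [gg] at h1
    rw [hdec, List.count_append] at h1
    have h2 := Bool.xor_right_inj.mp h1
    simp only [decide_eq_decide] at h2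
    rw [Nat.odd_add] at h2
    have h3 : ¬ Even (List.count t ((L.take b.val).drop a.val)) := Nat.not_even_iff_odd.mpr ht
    tauto
  intro a b he
  by_contra hne
  have : a.val ≠ b.val := fun h => hne (Fin.ext h)
  rcases lt_or_gt_of_ne this with h | h
  · exact main a b h he
  · exact main b a h he.symm

theorem num_eq {j k : ℕ} (hj : 0 < j) (c : Fin k → ℕ)
    (hst : ∀ τ : Equiv.Perm (Fin k), (∀ t, c (τ t) = c t) → ∀ t, τ t = t) :
    numEquivClasses j k c =
      ((Fintype.piFinset fun _ : Fin j => goodF (Finset.univ : Finset (Fin k))).filter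
        fun f => ∀ t, ∑ i, (f i).count t = c t).card := by
  classical
  have h0 : 0 < 2 ^ k := by positivity
  set Z := (Fintype.piFinset fun _ : Fin j => goodF (Finset.univ : Finset (Fin k))).filter
        fun f => ∀ t, ∑ i, (f i).count t = c t with hZ
  have hmemZ : ∀ f, f ∈ Z ↔ (∀ i, GoodL Finset.univ (f i)) ∧ ∀ t, ∑ i, (f i).count t = c t := by
    intro f; simp [hZ, mem_goodF]
  have hDex : ∀ (G : {G // IsEquipartingMatrix j k c G}) (i : Fin j), ∃ D, IsDeltaOf k (G.1 i) D :=
    fun G i => delta_exists (G.2.1 i)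
  choose D hD using hDex
  let F : {G // IsEquipartingMatrix j k c G} → Z := fun G => ⟨fun i => List.ofFn (D G i), by
    rw [hmemZ]
    refine ⟨fun i => delta_good (G.2.1 i) (hD G i), fun t => ?_⟩
    rw [← G.2.2.2 t]
    exact Finset.sum_congr rfl fun i _ => (delta_count (hD G i) t).symm⟩
  have hF : ∀ G G' : {G // IsEquipartingMatrix j k c G}, EMEquiv j k c G.1 G'.1 → F G = F G' := by
    rintro G G' ⟨β, τ, h1, h2⟩
    have h3 := hst τ h1
    apply Subtype.ext
    funext i
    show List.ofFn (D G i) = List.ofFn (D G' i)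
    congr 1
    apply delta_unique (g := G'.1 i) _ (hD G' i)
    intro p t
    rw [← hD G i p t, h2, h2, h3]
    simp
  have hF2 : ∀ G G' : {G // IsEquipartingMatrix j k c G}, F G = F G' → EMEquiv j k c G.1 G'.1 := by
    intro G G' he
    have he' : ∀ i, List.ofFn (D G i) = List.ofFn (D G' i) := fun i =>
      congrFun (congrArg Subtype.val he) i
    let β : Fin k → Bool := fun t => xor (G'.1 ⟨0, hj⟩ ⟨0, h0⟩ t) (G.1 ⟨0, hj⟩ ⟨0, h0⟩ t)
    have inner : ∀ i t, G'.1 i ⟨0, h0⟩ t = xor (β t) (G.1 i ⟨0, h0⟩ t) → ∀ m,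
        G'.1 i m t = xor (β t) (G.1 i m t) := by
      intro i t h m
      have e1 := delta_key (hD G i) t h0 m.1 m.2
      have e2 := delta_key (hD G' i) t h0 m.1 m.2
      simp only [Fin.eta] at e1 e2
      rw [e1, e2, h, he' i, Bool.xor_assoc]
    have outer : ∀ i (hi : i < j), ∀ t, G'.1 ⟨i, hi⟩ ⟨0, h0⟩ t =
        xor (β t) (G.1 ⟨i, hi⟩ ⟨0, h0⟩ t) := by
      intro i
      induction i with
      | zero => intro hi t; simp [β]
      | succ i ih =>
        intro hi t
        rw [← G.2.2.1 ⟨i, by omega⟩ hi, ← G'.2.2.1 ⟨i, by omega⟩ hi]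
        exact inner _ t (ih (by omega) t) _
    exact ⟨β, 1, fun _ => rfl, fun i m t => inner i t (outer i.1 i.2 t) m⟩
  have hF3 : Function.Surjective F := by
    rintro ⟨f, hf⟩
    have hf' := (hmemZ f).mp hf
    have hlen : ∀ i, (f i).length = 2 ^ k - 1 := fun i => by simpa using (hf'.1 i).1
    let v : ℕ → Fin k → Bool := fun i t =>
      decide (Odd (∑ l ∈ Finset.range i, if h : l < j then (f ⟨l, h⟩).count t else 0))
    have hd := fun i : Fin j => gg_delta (v i.1) (f i) (hlen i)
    have hof : ∀ i, List.ofFn (fun p : Fin (2 ^ k - 1) => (f i)[p.val]'(by rw [hlen i]; exact p.2))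
        = f i := by
      intro i
      apply List.ext_getElem
      · simp [hlen i]
      · intro n h1 h2; simp
    let G : {G // IsEquipartingMatrix j k c G} := ⟨fun i => gg (v i.1) (f i), by
      refine ⟨fun i => gg_gray _ _ (hf'.1 i), ?_, ?_⟩
      · intro i hi
        funext t
        simp only [gg, v]
        rw [Finset.sum_range_succ, dif_pos i.2, List.take_of_length_le (by rw [hlen i])]
        simp only [List.take_zero, List.count_nil, Fin.eta]
        generalize (∑ l ∈ Finset.range i.1, if h : l < j then (f ⟨l, h⟩).count t else 0) = x
        generalize (f i).count t = y
        rw [odd_add_xor]; simp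
      · intro t
        rw [← hf'.2 t]
        refine Finset.sum_congr rfl fun i _ => ?_
        rw [delta_count (hd i) t, hof]⟩
    refine ⟨G, ?_⟩
    apply Subtype.ext
    funext i
    show List.ofFn (D G i) = f i
    rw [← hof i]
    congr 1
    exact delta_unique (hD G i) (hd i)
  have e : Quot (fun G G' : {G // IsEquipartingMatrix j k c G} => EMEquiv j k c G.1 G'.1) ≃ Z :=
    Equiv.ofBijective (Quot.lift F hF) ⟨by
      rintro ⟨G⟩ ⟨G'⟩ h
      exact Quot.sound (hF2 G G' h), fun z => by
      obtain ⟨G, hG⟩ := hF3 z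
      exact ⟨Quot.mk _ G, hG⟩⟩
  rw [numEquivClasses, Nat.card_congr e, Nat.card_eq_fintype_card, Fintype.card_coe]

/-- For `k > 2`, `n ≥ 1`, `0 ≤ r < 2^n` and `j = 2^n + r`, with `w = min(r, 2^(n-1))`
and `s = r - w`, the number of equivalence classes of `c`-equiparting matrices is odd,
where (1-indexed) `cᵢ = 2^(i-1)·2^n + 2^i·w + 2^(i+1)·s` for `1 ≤ i ≤ k-2`,
`c_{k-1} = 2^(k-2)·2^n + 2^(k-1)·w + 2s` and `c_k = 2^(k-1)·2^n + w + s`. -/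
theorem odd_numEquivClasses_general (k n r : ℕ) (hk : 2 < k) (hn : 1 ≤ n)
    (hr : r < 2 ^ n) :
    Odd (numEquivClasses (2 ^ n + r) k
      (fun t =>
        if t.val + 3 ≤ k then
          2 ^ t.val * 2 ^ n + 2 ^ (t.val + 1) * min r (2 ^ (n - 1)) +
            2 ^ (t.val + 2) * (r - min r (2 ^ (n - 1)))
        else if t.val + 2 = k then
          2 ^ (k - 2) * 2 ^ n + 2 ^ (k - 1) * min r (2 ^ (n - 1)) +
            2 * (r - min r (2 ^ (n - 1)))
        else
          2 ^ (k - 1) * 2 ^ n + min r (2 ^ (n - 1)) + (r - min r (2 ^ (n - 1))))) := by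
  obtain ⟨W, T, hW, hT, hWT, hor, hw, hs⟩ := setup n r hn hr
  set c : Fin k → ℕ := _ with hcdef
  change Odd (numEquivClasses (2 ^ n + r) k c)
  have hc : ∀ t, c t = ∑ b ∈ insert n (W ∪ T), 2 ^ (b + phi0 n W b t) := by
    intro t
    rw [phi0_sum hk W T hW hT hWT t, hw, hs]
  have hnB : n ∉ W ∪ T := by
    intro h; rcases Finset.mem_union.mp h with h | h
    exacts [lt_irrefl _ (hW n h), lt_irrefl _ (hT n h)]
  have hj : ∑ b ∈ insert n (W ∪ T), 2 ^ b = 2 ^ n + r := by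
    rw [Finset.sum_insert hnB, Finset.sum_union hWT, hw, hs]; omega
  rw [num_eq (by positivity) c (stab_trivial hk W T hW hT hWT hor c hc),
    ← ZMod.natCast_eq_one_iff_odd, ← coeff_count, ← hj]
  exact coeff_one hk W T hW hT hWT hor c hc
end
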